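/- arXiv:1608.00846 — 2 statements merged into one kernel-verified Lean document; each statement's English description precedes it below -/
import Mathlib

section
/- Let Z ⊂ ℙV be a positive-dimensional nonsingular nondegenerate complete intersection. Then Z is tangentially nondegenerate: if A ∈ Hom(Λ²V, V) satisfies A(u,v) = 0 for every u in the affine cone Ẑ and every v in the affine tangent space T_u(Ẑ), then A = 0. -/
open MvPolynomial

section TNAlg
open RingTheory.Sequence IsLocalRing CategoryTheory Abelian Pointwise

/-- depth at least `d`. -/
def TNDepth (R : Type) [CommRing R] [IsLocalRing R] (M : Type) [AddCommGroup M] [Module R M]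
    (d : ℕ) : Prop :=
  ∃ rs : List R, rs.length = d ∧ (∀ r ∈ rs, r ∈ maximalIdeal R) ∧ IsRegular M rs

lemma tn_smul_lt (R : Type) [CommRing R] [IsLocalRing R] (M : Type)
    [AddCommGroup M] [Module R M] [Module.Finite R M] [Nontrivial M] (I : Ideal R)
    (hI : I ≤ maximalIdeal R) :
    I • (⊤ : Submodule R M) < ⊤ := by
  rw [lt_top_iff_ne_top]
  intro h
  have := Submodule.eq_bot_of_le_smul_of_le_jacobson_bot I (⊤ : Submodule R M)
    Module.Finite.fg_top h.ge (hI.trans (maximalIdeal_le_jacobson _))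
  exact top_ne_bot this

lemma tn_depth_quot (R : Type) [CommRing R] [IsLocalRing R] [IsNoetherianRing R] (M : Type)
    [AddCommGroup M] [Module R M] [Module.Finite R M] [Nontrivial M] (x : R)
    (hx : IsSMulRegular M x) (hxm : x ∈ maximalIdeal R) (d : ℕ) (h : TNDepth R M (d + 1)) :
    TNDepth R (QuotSMulTop x M) d := by
  have hnt : Nontrivial (QuotSMulTop x M) := nontrivial_quotSMulTop_of_mem_maximalIdeal M hxm
  have t1 := (ModuleCat.exists_isRegular_tfae (maximalIdeal R) (d + 1) (ModuleCat.of R M)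
    (tn_smul_lt R M _ le_rfl)).out 1 3
  have t2 := (ModuleCat.exists_isRegular_tfae (maximalIdeal R) d
    (ModuleCat.of R (QuotSMulTop x M)) (tn_smul_lt R (QuotSMulTop x M) _ le_rfl)).out 1 3
  have h1 := t1.mpr h
  refine t2.mp ?_
  intro i hi
  have zero1 := AddCommGrpCat.isZero_of_iff_subsingleton.mpr (h1 i (by omega))
  have zero2 := AddCommGrpCat.isZero_of_iff_subsingleton.mpr (h1 (i + 1) (by omega))
  have hx' : IsSMulRegular (ModuleCat.of R M) x := hx
  exact AddCommGrpCat.subsingleton_of_isZero <| ShortComplex.Exact.isZero_of_both_zeros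
    ((Ext.covariant_sequence_exact₃' _ hx'.smulShortComplex_shortExact) i (i + 1) rfl)
    (zero1.eq_zero_of_src _) (zero2.eq_zero_of_tgt _)

/-- move depth to another ideal with the same radical -/
lemma tn_depth_ideal (R : Type) [CommRing R] [IsLocalRing R] [IsNoetherianRing R] (M : Type)
    [AddCommGroup M] [Module R M] [Module.Finite R M] [Nontrivial M] (I : Ideal R)
    (hI : I ≤ maximalIdeal R)
    (hI' : ∀ Q : Ideal R, Q.IsPrime → I ≤ Q → Q = maximalIdeal R) (d : ℕ) (h : TNDepth R M d) :
    ∃ rs : List R, rs.length = d ∧ (∀ r ∈ rs, r ∈ I) ∧ IsRegular M rs := by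
  have t1 := (ModuleCat.exists_isRegular_tfae (maximalIdeal R) d (ModuleCat.of R M)
    (tn_smul_lt R M _ le_rfl)).out 0 3
  have t2 := (ModuleCat.exists_isRegular_tfae I d (ModuleCat.of R M)
    (tn_smul_lt R M _ hI)).out 0 3
  refine t2.mp ?_
  have h1 := t1.mpr h
  intro N hN hf hs
  refine h1 N hN hf (hs.trans ?_)
  intro p hp
  have := hI' p.asIdeal p.2 hp
  rw [PrimeSpectrum.mem_zeroLocus, this]

lemma tn_dim_lt (R : Type) [CommRing R] (Q Q' : Ideal R) [Q.IsPrime] (h : Q ≤ Q') (y : R)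
    (hy : y ∉ Q) (hy' : y ∈ Q') : ringKrullDim (R ⧸ Q') + 1 ≤ ringKrullDim (R ⧸ Q) := by
  refine ringKrullDim_succ_le_of_surjective (Ideal.Quotient.factor h)
    (Ideal.Quotient.factor_surjective h) (r := Ideal.Quotient.mk Q y) ?_ ?_
  · rw [mem_nonZeroDivisors_iff_ne_zero]
    simpa [Ideal.Quotient.eq_zero_iff_mem] using hy
  · simpa [Ideal.Quotient.eq_zero_iff_mem] using hy'

lemma tn_depth_le_dim (R : Type) [CommRing R] [IsLocalRing R] [IsNoetherianRing R] (rs : List R) :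
    ∀ (M : Type) [AddCommGroup M] [Module R M] [Module.Finite R M]
    (_ : ∀ r ∈ rs, r ∈ maximalIdeal R) (_ : IsRegular M rs) (Q : Ideal R)
    (_ : IsAssociatedPrime Q M), (rs.length : WithBot ℕ∞) ≤ ringKrullDim (R ⧸ Q) := by
  induction rs with
  | nil =>
    intro M _ _ _ _ _ Q hQ
    have := hQ.isPrime
    simpa using ringKrullDim_nonneg_of_nontrivial
  | cons y ys ih =>
    intro M _ _ _ hm hreg Q hQ
    rw [isRegular_cons_iff] at hreg
    have hQp := hQ.isPrime
    obtain ⟨-, z, hz⟩ := isAssociatedPrime_iff.mp hQ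
    have hzQ : ∀ r, r ∈ Q ↔ r • z = 0 := by
      intro r; rw [hz, Submodule.mem_colon_singleton, Submodule.mem_bot]
    have hz0 : z ≠ 0 := by
      rintro rfl
      exact hQp.ne_top ((Ideal.eq_top_iff_one _).mpr (by rw [hzQ]; simp))
    have hyQ : y ∉ Q := by
      intro h
      rw [hzQ] at h
      exact hz0 (hreg.1 (by simpa using h))
    let N : Submodule R M := ⨅ r : Q, LinearMap.ker (LinearMap.lsmul R M r.1)
    have hN : ∀ w, w ∈ N ↔ ∀ r ∈ Q, r • w = 0 := by
      intro w; simp [N, Submodule.mem_iInf]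
    obtain ⟨w, hwN, hw⟩ : ∃ w ∈ N, w ∉ y • (⊤ : Submodule R M) := by
      by_contra! hcon
      have : N = ⊥ := by
        refine Submodule.eq_bot_of_le_smul_of_le_jacobson_bot (Ideal.span {y}) N
          (IsNoetherian.noetherian N) ?_ ?_
        · intro w hw
          obtain ⟨v, -, rfl⟩ := (Submodule.mem_smul_pointwise_iff_exists _ _ _).mp (hcon w hw)
          refine Submodule.smul_mem_smul (Ideal.mem_span_singleton_self y) ?_
          rw [hN] at hw ⊢
          intro r hr
          have := hw r hr
          rw [smul_comm] at this
          exact hreg.1 (by simpa using this)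
        · rw [Ideal.span_le, Set.singleton_subset_iff]
          exact maximalIdeal_le_jacobson _ (hm y (by simp))
      have hzN : z ∈ N := by rw [hN]; intro r hr; exact (hzQ r).mp hr
      rw [this] at hzN
      exact hz0 (by simpa using hzN)
    let w' : QuotSMulTop y M := Submodule.Quotient.mk w
    have hw' : w' ≠ 0 := by
      intro h
      exact hw ((Submodule.Quotient.mk_eq_zero _).mp h)
    obtain ⟨Q', hQ', hle⟩ := exists_le_isAssociatedPrime_of_isNoetherianRing R w' hw'
    have hQQ' : Q ≤ Q' := by
      refine le_trans ?_ hle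
      intro r hr
      rw [Submodule.mem_colon_singleton, Submodule.mem_bot]
      change Submodule.Quotient.mk (r • w) = (0 : QuotSMulTop y M)
      rw [(hN w).mp hwN r hr, Submodule.Quotient.mk_zero]
    have hyQ' : y ∈ Q' := by
      apply hle
      rw [Submodule.mem_colon_singleton, Submodule.mem_bot]
      change Submodule.Quotient.mk (y • w) = (0 : QuotSMulTop y M)
      rw [Submodule.Quotient.mk_eq_zero]
      exact Submodule.smul_mem_pointwise_smul _ _ _ trivial
    have h1 := ih (QuotSMulTop y M) (fun r hr => hm r (by simp [hr])) hreg.2 Q' hQ'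
    have h2 := tn_dim_lt R Q Q' hQQ' y hyQ hyQ'
    refine le_trans ?_ h2
    rw [List.length_cons, Nat.cast_add, Nat.cast_one]
    gcongr

lemma tn_dim_list (R : Type) [CommRing R] [IsLocalRing R] [IsNoetherianRing R] (Q : Ideal R)
    [Q.IsPrime] (gs : List R) (hg : ∀ r ∈ gs, r ∈ maximalIdeal R) :
    ringKrullDim (R ⧸ Q) ≤ ringKrullDim (R ⧸ (Q ⊔ Ideal.ofList gs)) + gs.length := by
  classical
  have : IsLocalRing (R ⧸ Q) :=
    IsLocalRing.of_surjective' (Ideal.Quotient.mk Q) Ideal.Quotient.mk_surjective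
  let s : Finset (R ⧸ Q) := (gs.map (Ideal.Quotient.mk Q)).toFinset
  have hs : (s : Set (R ⧸ Q)) ⊆ Ring.jacobson (R ⧸ Q) := by
    intro t ht
    simp only [s, List.coe_toFinset, List.mem_map, Set.mem_ofPred_eq] at ht
    obtain ⟨r, hr, rfl⟩ := ht
    rw [IsLocalRing.ringJacobson_eq_maximalIdeal]
    have hrr := hg r hr
    rw [SetLike.mem_coe]
    rw [mem_maximalIdeal, mem_nonunits_iff] at hrr ⊢
    intro hu
    have := IsLocalHom.of_surjective (Ideal.Quotient.mk Q) Ideal.Quotient.mk_surjective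
    exact hrr ((isUnit_map_iff (Ideal.Quotient.mk Q) r).mp hu)
  refine (ringKrullDim_le_ringKrullDim_quotient_add_card s hs).trans ?_
  gcongr
  · have hle : Ideal.span (s : Set (R ⧸ Q)) = (Ideal.ofList gs).map (Ideal.Quotient.mk Q) := by
      rw [Ideal.map_ofList, Ideal.ofList]
      simp [s]
    rw [hle]
    exact (ringKrullDim_eq_of_ringEquiv (DoubleQuot.quotQuotEquivQuotSup Q (Ideal.ofList gs))).le
  · refine (List.toFinset_card_le _).trans ?_
    simp

lemma tn_G (R : Type) [CommRing R] [IsLocalRing R] [IsNoetherianRing R] (gs : List R) :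
    ∀ (M : Type) [AddCommGroup M] [Module R M] [Module.Finite R M] [Nontrivial M] (n : ℕ)
    (_ : ∀ r ∈ gs, r ∈ maximalIdeal R) (_ : TNDepth R M (n + gs.length))
    (_ : ∀ J : Ideal R, J ≠ ⊤ → Module.annihilator R M ≤ J → Ideal.ofList gs ≤ J →
      ringKrullDim (R ⧸ J) ≤ n),
    IsWeaklyRegular M gs ∧ TNDepth R (M ⧸ (Ideal.ofList gs • ⊤ : Submodule R M)) n := by
  induction gs with
  | nil =>
    intro M _ _ _ _ n _ hd _
    refine ⟨IsWeaklyRegular.nil R M, ?_⟩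
    obtain ⟨rs, h1, h2, h3⟩ := hd
    refine ⟨rs, by simpa using h1, h2, ?_⟩
    have : (Ideal.ofList ([] : List R) • ⊤ : Submodule R M) = ⊥ := by
      rw [Ideal.ofList_nil, Submodule.bot_smul]
    exact ((Submodule.quotEquivOfEqBot _ this).isRegular_congr rs).mpr h3
  | cons x gs ih =>
    intro M _ _ _ _ n hm hd hH
    have hxm : x ∈ maximalIdeal R := hm x (by simp)
    have hgm : ∀ r ∈ gs, r ∈ maximalIdeal R := fun r hr => hm r (by simp [hr])
    have hxreg : IsSMulRegular M x := by
      by_contra hcon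
      have : ∃ z : M, z ≠ 0 ∧ x • z = 0 := by
        by_contra! h
        apply hcon
        intro a b hab
        by_contra hne
        refine h (a - b) (sub_ne_zero.mpr hne) ?_
        rw [smul_sub]; exact sub_eq_zero.mpr hab
      obtain ⟨z, hz0, hz⟩ := this
      obtain ⟨Q, hQ, hle⟩ := exists_le_isAssociatedPrime_of_isNoetherianRing R z hz0
      have hQp := hQ.isPrime
      have hxQ : x ∈ Q := hle (by rw [Submodule.mem_colon_singleton, Submodule.mem_bot]; exact hz)
      obtain ⟨rs, h1, h2, h3⟩ := hd
      have hdim := tn_depth_le_dim R rs M h2 h3 Q hQ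
      have hdim2 := tn_dim_list R Q gs hgm
      have hann : Module.annihilator R M ≤ Q := by
        have := hQ.annihilator_le
        rwa [Submodule.annihilator_top] at this
      have hdim3 := hH (Q ⊔ Ideal.ofList gs) ?_ (hann.trans le_sup_left) ?_
      · rw [h1] at hdim
        have h4 := hdim.trans (hdim2.trans (add_le_add_left hdim3 _))
        rw [List.length_cons] at h4
        norm_cast at h4
        omega
      · intro htop
        have : Q ⊔ Ideal.ofList gs ≤ maximalIdeal R :=
          sup_le (le_maximalIdeal hQp.ne_top) (Ideal.span_le.mpr hgm)
        rw [htop] at this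
        exact (maximalIdeal.isMaximal R).ne_top (top_le_iff.mp this)
      · rw [Ideal.ofList_cons]
        refine sup_le_sup_right ?_ _
        rwa [Ideal.span_singleton_le_iff_mem]
    have hnt : Nontrivial (QuotSMulTop x M) := nontrivial_quotSMulTop_of_mem_maximalIdeal M hxm
    have hd' := tn_depth_quot R M x hxreg hxm (n + gs.length) hd
    have hH' : ∀ J : Ideal R, J ≠ ⊤ → Module.annihilator R (QuotSMulTop x M) ≤ J →
        Ideal.ofList gs ≤ J → ringKrullDim (R ⧸ J) ≤ n := by
      intro J hJ hann hg
      refine hH J hJ (le_trans ?_ hann) ?_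
      · exact LinearMap.annihilator_le_of_surjective (Submodule.mkQ (x • (⊤ : Submodule R M)))
          (Submodule.mkQ_surjective _)
      · rw [Ideal.ofList_cons]
        refine sup_le ?_ hg
        rw [Ideal.span_singleton_le_iff_mem]
        exact hann (QuotSMulTop.mem_annihilator M x)
    obtain ⟨k1, rs, k2, k3, k4⟩ := ih (QuotSMulTop x M) n hgm hd' hH'
    · refine ⟨(isWeaklyRegular_cons_iff M x gs).mpr ⟨hxreg, k1⟩, rs, k2, k3, ?_⟩
      exact ((Submodule.quotOfListConsSMulTopEquivQuotSMulTopInner M x gs).isRegular_congr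
        rs).mpr k4

/-- regularity modulo an ideal, concretely -/
lemma tn_reg_iff (R : Type) [CommRing R] (J : Ideal R) (b : R)
    (h : IsSMulRegular (R ⧸ (J • ⊤ : Submodule R R)) b) (z : R) (hz : b * z ∈ J) : z ∈ J := by
  have hJ : (J • ⊤ : Submodule R R) = J := by simp
  rw [hJ] at h
  have : (Submodule.Quotient.mk z : R ⧸ J) = 0 := by
    apply h
    simp only [smul_zero]
    rw [← Submodule.Quotient.mk_smul]
    exact (Submodule.Quotient.mk_eq_zero _).mpr hz
  exact (Submodule.Quotient.mk_eq_zero _).mp this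

lemma tn_Dom (R : Type) [CommRing R] [IsLocalRing R] [IsNoetherianRing R] (bs : List R) :
    ∀ (as : List R), IsWeaklyRegular R (as ++ bs) → Ideal.ofList (as ++ bs) = maximalIdeal R →
    (Ideal.ofList as).IsPrime := by
  induction bs with
  | nil =>
    intro as _ h
    rw [List.append_nil] at h
    rw [h]; infer_instance
  | cons b bs ih =>
    intro as hreg hm
    have hp := ih (as ++ [b]) (by simpa using hreg) (by simpa using hm)
    have hb : ∀ z, b * z ∈ Ideal.ofList as → z ∈ Ideal.ofList as := by
      have := ((isWeaklyRegular_append_iff R as (b :: bs)).mp hreg).2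
      rw [isWeaklyRegular_cons_iff] at this
      exact tn_reg_iff R _ b this.1
    have hbm : b ∈ maximalIdeal R := by
      rw [← hm]; exact Ideal.subset_span (by simp)
    have hle : Ideal.ofList as ≤ Ideal.ofList (as ++ [b]) := by
      rw [Ideal.ofList_append]; exact le_sup_left
    obtain ⟨q, hq, hqle⟩ := Ideal.exists_minimalPrimes_le hle
    have hqp : q.IsPrime := hq.1.1
    have hbq : b ∉ q := by
      intro hbq
      obtain ⟨y, hy, hxy⟩ := Ideal.exists_mul_mem_of_mem_minimalPrimes hq hbq
      exact hy (hb y hxy)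
    have : q ≤ Ideal.ofList as := by
      refine Submodule.le_of_le_smul_of_le_jacobson_bot (I := Ideal.span {b})
        (IsNoetherian.noetherian q) ?_ ?_
      · rw [Ideal.span_singleton_le_iff_mem]; exact maximalIdeal_le_jacobson _ hbm
      · intro x hx
        have hx' := hqle hx
        rw [Ideal.ofList_append, Ideal.ofList_singleton] at hx'
        obtain ⟨j, hj, t, ht, rfl⟩ := Submodule.mem_sup.mp hx'
        obtain ⟨z, rfl⟩ := Ideal.mem_span_singleton'.mp ht
        refine Submodule.add_mem_sup hj ?_
        have : z * b ∈ q := by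
          have := q.sub_mem hx (hq.1.2 hj)
          simpa using this
        rw [mul_comm]
        exact Submodule.smul_mem_smul (Ideal.mem_span_singleton_self b)
          ((hqp.mem_or_mem this).resolve_right hbq)
    have : q = Ideal.ofList as := le_antisymm this hq.1.2
    rw [← this]; exact hqp

lemma tn_height (R : Type) [CommRing R] [IsLocalRing R] [IsNoetherianRing R] (as : List R) :
    ∀ (bs : List R), IsWeaklyRegular R (as ++ bs) → Ideal.ofList (as ++ bs) = maximalIdeal R →
    (as.length : ℕ∞) ≤ (Ideal.ofList as).height := by
  induction as using List.reverseRecOn with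
  | nil => intro bs _ _; simp
  | append_singleton as b ih =>
    intro bs hreg hm
    have h1 := ih (b :: bs) (by simpa using hreg) (by simpa using hm)
    have hp1 := tn_Dom R (b :: bs) as (by simpa using hreg) (by simpa using hm)
    have hp2 := tn_Dom R bs (as ++ [b]) hreg hm
    have hb : b ∉ Ideal.ofList as := by
      intro hb
      have h2 : IsWeaklyRegular R (as ++ (b :: bs)) := by simpa using hreg
      have := ((isWeaklyRegular_append_iff R as (b :: bs)).mp h2).2
      rw [isWeaklyRegular_cons_iff] at this
      have := tn_reg_iff R _ b this.1 1 (by simpa using hb)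
      exact hp1.ne_top ((Ideal.eq_top_iff_one _).mpr this)
    have hlt : Ideal.ofList as < Ideal.ofList (as ++ [b]) := by
      refine lt_of_le_of_ne (by rw [Ideal.ofList_append]; exact le_sup_left) ?_
      intro h
      apply hb
      rw [h]; exact Ideal.subset_span (by simp)
    have := Ideal.height_add_one_le_of_lt_of_isPrime hlt
    refine le_trans ?_ this
    simp only [List.length_append, List.length_singleton, Nat.cast_add, Nat.cast_one]
    gcongr

end TNAlg

section TNLoc
open RingTheory.Sequence IsLocalRing

/-- maximal ideal of a point -/
noncomputable def tnm {n : ℕ} (u : Fin n → ℂ) : Ideal (MvPolynomial (Fin n) ℂ) := RingHom.ker (eval u)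

lemma tn_mem_m {n : ℕ} (u : Fin n → ℂ) (p : MvPolynomial (Fin n) ℂ) :
    p ∈ tnm u ↔ eval u p = 0 := RingHom.mem_ker

instance tn_m_max {n : ℕ} (u : Fin n → ℂ) : (tnm u).IsMaximal :=
  RingHom.ker_isMaximal_of_surjective _ (fun c => ⟨C c, by simp⟩)

lemma tn_X_reg {n : ℕ} (s : Set (Fin n)) (k : Fin n) (hk : k ∉ s)
    (p : MvPolynomial (Fin n) ℂ) (h : X k * p ∈ Ideal.span (X '' s : Set (MvPolynomial (Fin n) ℂ))) :
    p ∈ Ideal.span (X '' s : Set (MvPolynomial (Fin n) ℂ)) := by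
  classical
  rw [mem_ideal_span_X_image] at h ⊢
  intro m hm
  obtain ⟨i, hi, hi'⟩ := h (Finsupp.single k 1 + m) (by
    rw [mem_support_iff] at hm ⊢
    rwa [add_comm, mul_comm, coeff_mul_X])
  refine ⟨i, hi, ?_⟩
  have : k ≠ i := by rintro rfl; exact hk hi
  simpa [Finsupp.single_apply, this] using hi'

lemma tn_Xu_reg {n : ℕ} (u : Fin n → ℂ) (s : Set (Fin n)) (k : Fin n) (hk : k ∉ s)
    (p : MvPolynomial (Fin n) ℂ)
    (h : (X k - C (u k)) * p ∈ Ideal.span ((fun i => X i - C (u i)) '' s)) :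
    p ∈ Ideal.span ((fun i => X i - C (u i)) '' s) := by
  let φ : MvPolynomial (Fin n) ℂ →ₐ[ℂ] MvPolynomial (Fin n) ℂ := aeval (fun i => X i - C (u i))
  let ψ : MvPolynomial (Fin n) ℂ →ₐ[ℂ] MvPolynomial (Fin n) ℂ := aeval (fun i => X i + C (u i))
  have hφψ : ∀ p, φ (ψ p) = p := by
    intro p
    have : φ.comp ψ = AlgHom.id ℂ _ := by
      ext i
      simp [φ, ψ, algebraMap_eq]
    exact DFunLike.congr_fun this p
  have hC : ∀ a, ψ (C a) = C a := fun a => by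
    simp [ψ, algebraMap_eq]
  have h1 := Ideal.mem_map_of_mem ψ.toRingHom h
  rw [Ideal.map_span, Set.image_image] at h1
  have e1 : ∀ i, ψ.toRingHom (X i - C (u i)) = X i := by
    intro i
    change ψ (X i - C (u i)) = X i
    rw [map_sub, hC]
    simp [ψ]
  simp only [e1, map_mul] at h1
  have h2 := tn_X_reg s k hk _ h1
  have h3 := Ideal.mem_map_of_mem φ.toRingHom h2
  rw [Ideal.map_span, Set.image_image] at h3
  have e2 : φ.toRingHom (ψ.toRingHom p) = p := hφψ p
  have e3 : ∀ i, φ.toRingHom (X i) = X i - C (u i) := by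
    intro i
    change φ (X i) = _
    simp [φ]
  rw [e2] at h3
  simp only [e3] at h3
  exact h3

lemma tn_reg_iff' (R : Type) [CommRing R] (J : Ideal R) (b : R)
    (h : ∀ z, b * z ∈ J → z ∈ J) : IsSMulRegular (R ⧸ (J • ⊤ : Submodule R R)) b := by
  have hJ : (J • ⊤ : Submodule R R) = J := by simp
  rw [hJ, isSMulRegular_iff_right_eq_zero_of_smul]
  intro z hz
  obtain ⟨z, rfl⟩ := Submodule.Quotient.mk_surjective _ z
  rw [← Submodule.Quotient.mk_smul] at hz
  exact (Submodule.Quotient.mk_eq_zero _).mpr (h z ((Submodule.Quotient.mk_eq_zero _).mp hz))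

lemma tn_wreg {n : ℕ} (u : Fin n → ℂ) : IsWeaklyRegular (MvPolynomial (Fin n) ℂ)
    (List.ofFn (fun i => (X i - C (u i) : MvPolynomial (Fin n) ℂ))) := by
  rw [isWeaklyRegular_iff]
  intro i hi
  apply tn_reg_iff'
  intro z hz
  have hin : i < n := by simpa using hi
  have key : Ideal.ofList (List.take i (List.ofFn (fun i => (X i - C (u i) : MvPolynomial (Fin n) ℂ))))
     = Ideal.span ((fun i => X i - C (u i)) '' {j | j.1 < i}) := by
    rw [Ideal.ofList]
    congr 1
    ext p
    simp only [List.mem_take_iff_getElem, Set.mem_image]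
    constructor
    · rintro ⟨j, hj, rfl⟩
      have hj' : j < i ∧ j < n := by simpa using hj
      exact ⟨⟨j, hj'.2⟩, hj'.1, by simp⟩
    · rintro ⟨j, hj, rfl⟩
      exact ⟨j, by simpa using hj, by simp⟩
  rw [key] at hz ⊢
  rw [List.getElem_ofFn] at hz
  exact tn_Xu_reg u _ ⟨i, hin⟩ (by simp) z hz

lemma tn_depth_L {n : ℕ} (u : Fin n → ℂ) (L : Type) [CommRing L] [IsLocalRing L]
    [Algebra (MvPolynomial (Fin n) ℂ) L] [IsLocalization.AtPrime L (tnm u)] :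
    TNDepth L L n := by
  refine ⟨_, ?_, ?_, (tn_wreg u).isRegular_of_isLocalization_of_mem L (tnm u) ?_⟩
  · simp
  · intro r hr
    simp only [List.mem_map, List.mem_ofFn] at hr
    obtain ⟨_, ⟨i, rfl⟩, rfl⟩ := hr
    rw [IsLocalization.AtPrime.to_map_mem_maximal_iff L (tnm u), tn_mem_m]
    simp
  · intro r hr
    simp only [List.mem_ofFn] at hr
    obtain ⟨i, rfl⟩ := hr
    rw [tn_mem_m]; simp

lemma tn_taylor {n : ℕ} (u : Fin n → ℂ) (p : MvPolynomial (Fin n) ℂ) :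
    p - C (eval u p) - ∑ j, C (eval u (pderiv j p)) * (X j - C (u j)) ∈ (tnm u) ^ 2 := by
  classical
  induction p using MvPolynomial.induction_on with
  | C a => simp
  | add p q hp hq =>
    convert add_mem hp hq using 1
    simp only [map_add, add_mul, Finset.sum_add_distrib]
    ring
  | mul_X p i hp =>
    have h1 : (∑ j, C (eval u (pderiv j p)) * (X j - C (u j))) * (X i - C (u i)) ∈ (tnm u) ^ 2 := by
      rw [pow_two]
      refine Ideal.mul_mem_mul ?_ ?_
      · refine Ideal.sum_mem _ (fun j _ => Ideal.mul_mem_left _ _ ?_)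
        rw [tn_mem_m]; simp
      · rw [tn_mem_m]; simp
    convert add_mem (Ideal.mul_mem_right (X i) _ hp) h1 using 1
    have h2 : ∑ j, C (eval u (pderiv j (p * X i))) * (X j - C (u j)) =
      C (u i) * (∑ j, C (eval u (pderiv j p)) * (X j - C (u j))) +
        C (eval u p) * (X i - C (u i)) := by
      have : C (eval u p) * (X i - C (u i)) =
          ∑ j, if j = i then C (eval u p) * (X j - C (u j)) else 0 := by simp
      rw [Finset.mul_sum, this, ← Finset.sum_add_distrib]
      refine Finset.sum_congr rfl fun j _ => ?_
      rw [Derivation.leibniz, pderiv_X]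
      by_cases hj : j = i
      · subst hj
        simp; ring
      · simp [hj, Ne.symm hj]; ring
    rw [h2]
    simp only [map_mul, eval_X]
    ring

/-- gradient at a point -/
noncomputable def tnD {n : ℕ} (u : Fin n → ℂ) : MvPolynomial (Fin n) ℂ →ₗ[ℂ] (Fin n → ℂ) :=
  LinearMap.pi fun j => (aeval u).toLinearMap ∘ₗ (pderiv j).toLinearMap

lemma tnD_apply {n : ℕ} (u : Fin n → ℂ) (p : MvPolynomial (Fin n) ℂ) (j : Fin n) :
    tnD u p j = eval u (pderiv j p) := by
  simp [tnD, aeval_eq_eval]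

lemma tn_coord {n : ℕ} (u : Fin n → ℂ) (L : Type) [CommRing L] [IsLocalRing L] [IsNoetherianRing L]
    [Algebra (MvPolynomial (Fin n) ℂ) L] [IsLocalization.AtPrime L (tnm u)]
    (ys : List (MvPolynomial (Fin n) ℂ)) (h0 : ∀ y ∈ ys, eval u y = 0)
    (h1 : Submodule.span ℂ (tnD u '' {y | y ∈ ys}) = ⊤) :
    Ideal.ofList (ys.map (algebraMap _ L)) = maximalIdeal L := by
  have hmax := IsLocalization.AtPrime.map_eq_maximalIdeal (tnm u) L
  have hle : Ideal.ofList ys ≤ tnm u := by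
    rw [Ideal.ofList, Ideal.span_le]
    intro y hy
    exact (tn_mem_m u y).mpr (h0 y hy)
  have key : tnm u ≤ Ideal.ofList ys ⊔ (tnm u) * tnm u := by
    intro p hp
    have hD : tnD u p ∈ Submodule.span ℂ (tnD u '' {y | y ∈ ys}) := by rw [h1]; trivial
    rw [← Submodule.map_span] at hD
    obtain ⟨q, hq, hqp⟩ := hD
    have hq' : q ∈ Ideal.ofList ys := by
      have := Submodule.span_le_restrictScalars ℂ (MvPolynomial (Fin n) ℂ) {y | y ∈ ys} hq
      exact this
    have hr : p - q ∈ (tnm u) ^ 2 := by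
      have := tn_taylor u (p - q)
      have e1 : eval u (p - q) = 0 := (tn_mem_m u _).mp (sub_mem hp (hle hq'))
      have e2 : ∀ j, eval u (pderiv j (p - q)) = 0 := by
        intro j
        rw [← tnD_apply, map_sub, hqp, sub_self]; rfl
      simpa [e1, e2, -map_sub] using this
    rw [pow_two] at hr
    have : p = q + (p - q) := by ring
    rw [this]
    exact Submodule.add_mem_sup hq' hr
  rw [← Ideal.map_ofList]
  refine le_antisymm (hmax ▸ Ideal.map_mono hle) ?_
  refine Submodule.le_of_le_smul_of_le_jacobson_bot (I := maximalIdeal L)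
        (IsNoetherian.noetherian _) (maximalIdeal_le_jacobson _) ?_
  have := Ideal.map_mono (f := algebraMap _ L) key
  rw [Ideal.map_sup, Ideal.map_mul, hmax] at this
  exact this

lemma tn_L {n c : ℕ} (u : Fin n → ℂ) (L : Type) [CommRing L] [IsLocalRing L] [IsNoetherianRing L]
    [Algebra (MvPolynomial (Fin n) ℂ) L] [IsLocalization.AtPrime L (tnm u)]
    (f : Fin c → MvPolynomial (Fin n) ℂ) (h0 : ∀ i, eval u (f i) = 0)
    (h1 : LinearIndependent ℂ (fun i : Fin c => fun j : Fin n => eval u (pderiv j (f i)))) :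
    ((Ideal.span (Set.range f)).map (algebraMap _ L)).IsPrime ∧
      (c : ℕ∞) ≤ ((Ideal.span (Set.range f)).map (algebraMap _ L)).height := by
  classical
  let b := Module.Basis.sumExtend h1
  have : Finite (Fin c ⊕ Module.Basis.sumExtendIndex h1) := Module.Finite.finite_basis b
  have : Finite (Module.Basis.sumExtendIndex h1) := Finite.sum_right (Fin c)
  have := Fintype.ofFinite (Module.Basis.sumExtendIndex h1)
  have hcard : c + Fintype.card (Module.Basis.sumExtendIndex h1) = n := by
    have := Module.finrank_eq_card_basis b
    simpa using this.symm
  let ℓ : Module.Basis.sumExtendIndex h1 → MvPolynomial (Fin n) ℂ := fun k =>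
    ∑ j, C (b (Sum.inr k) j) * (X j - C (u j))
  have hℓ0 : ∀ k, eval u (ℓ k) = 0 := by intro k; simp [ℓ]
  have hℓ1 : ∀ k, tnD u (ℓ k) = b (Sum.inr k) := by
    intro k; ext j
    rw [tnD_apply]
    simp [ℓ, Derivation.leibniz, pderiv_X, Pi.single_apply]
  have hf1 : ∀ i, tnD u (f i) = b (Sum.inl i) := by
    intro i; ext j
    rw [tnD_apply]
    simp [b, Module.Basis.sumExtend]
    rfl
  let as := List.ofFn f
  let bs := (Finset.univ : Finset (Module.Basis.sumExtendIndex h1)).toList.map ℓ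
  have hys0 : ∀ y ∈ as ++ bs, eval u y = 0 := by
    intro y hy
    simp only [as, bs, List.mem_append, List.mem_ofFn, List.mem_map, Finset.mem_toList] at hy
    rcases hy with ⟨i, rfl⟩ | ⟨k, -, rfl⟩
    · exact h0 i
    · exact hℓ0 k
  have hgen := tn_coord u L (as ++ bs) hys0 (by
    rw [← top_le_iff, ← b.span_eq, Submodule.span_le]
    rintro _ ⟨i | k, rfl⟩
    · rw [← hf1]
      exact Submodule.subset_span ⟨_, by simp [as], rfl⟩
    · rw [← hℓ1]
      exact Submodule.subset_span ⟨ℓ k, List.mem_append_right _ (List.mem_map_of_mem (by simp)), rfl⟩)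
  rw [List.map_append] at hgen
  have hreg := (tn_G L (as.map (algebraMap _ L) ++ bs.map (algebraMap _ L)) L 0 (by
      intro r hr
      rw [← hgen]; exact Ideal.subset_span hr) (by
      have := tn_depth_L u L
      convert this using 1
      refine Eq.trans ?_ hcard
      simp only [as, bs, List.length_append, List.length_map, List.length_ofFn,
        Finset.length_toList, Finset.card_univ, zero_add]) (by
      intro J hJ _ hle
      rw [hgen] at hle
      have : J = maximalIdeal L := le_antisymm (le_maximalIdeal hJ) hle
      subst this
      let _ := Ideal.Quotient.field (maximalIdeal L)
      simp [ringKrullDim_eq_zero_of_field])).1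
  have e : (Ideal.span (Set.range f)).map (algebraMap _ L) =
      Ideal.ofList (as.map (algebraMap _ L)) := by
    rw [← Ideal.map_ofList, Ideal.ofList]
    congr 2
    ext; simp [as, List.mem_ofFn]
  rw [e]
  refine ⟨tn_Dom L _ _ hreg hgen, ?_⟩
  simpa [as] using tn_height L _ _ hreg hgen

lemma tn_La {n c : ℕ} (u : Fin n → ℂ)
    (f : Fin c → MvPolynomial (Fin n) ℂ) (h0 : ∀ i, eval u (f i) = 0)
    (h1 : LinearIndependent ℂ (fun i : Fin c => fun j : Fin n => eval u (pderiv j (f i))))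
    (Q : Ideal (MvPolynomial (Fin n) ℂ)) [Q.IsPrime] (hQ : Ideal.span (Set.range f) ≤ Q)
    (hQm : Q ≤ tnm u) : (c : ℕ∞) ≤ Q.height := by
  have h := (tn_L u (Localization.AtPrime (tnm u)) f h0 h1).2
  rw [← IsLocalization.height_map_of_disjoint (S := Localization.AtPrime (tnm u))
    (tnm u).primeCompl Q]
  · exact h.trans (Ideal.height_mono (Ideal.map_mono hQ))
  · rw [Set.disjoint_left]
    intro x hx hx'
    exact hx (hQm hx')

lemma tn_Lb {n c : ℕ} (u : Fin n → ℂ)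
    (f : Fin c → MvPolynomial (Fin n) ℂ) (h0 : ∀ i, eval u (f i) = 0)
    (h1 : LinearIndependent ℂ (fun i : Fin c => fun j : Fin n => eval u (pderiv j (f i))))
    (g : MvPolynomial (Fin n) ℂ) (e : ℕ) (hg : g ^ e ∈ Ideal.span (Set.range f)) :
    ∃ s, eval u s ≠ 0 ∧ s * g ∈ Ideal.span (Set.range f) := by
  have h := (tn_L u (Localization.AtPrime (tnm u)) f h0 h1).1
  have h2 := Ideal.mem_map_of_mem (algebraMap _ (Localization.AtPrime (tnm u))) hg
  rw [map_pow] at h2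
  have h3 := h.mem_of_pow_mem _ h2
  rw [IsLocalization.algebraMap_mem_map_algebraMap_iff (tnm u).primeCompl] at h3
  obtain ⟨s, hs, hs'⟩ := h3
  exact ⟨s, fun h => hs ((tn_mem_m u s).mpr h), hs'⟩

end TNLoc

section TNMain
open RingTheory.Sequence IsLocalRing

lemma tn_pderiv_comm {n : ℕ} (j k : Fin n) (p : MvPolynomial (Fin n) ℂ) :
    pderiv j (pderiv k p) = pderiv k (pderiv j p) := by
  classical
  have : ⁅(pderiv j : Derivation ℂ (MvPolynomial (Fin n) ℂ) (MvPolynomial (Fin n) ℂ)),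
      (pderiv k : Derivation ℂ (MvPolynomial (Fin n) ℂ) (MvPolynomial (Fin n) ℂ))⁆ = 0 := by
    apply MvPolynomial.derivation_ext
    intro i
    rw [Derivation.commutator_apply, pderiv_X, pderiv_X]
    simp only [Pi.single_apply]
    split_ifs <;> simp
  have h := DFunLike.congr_fun this p
  rw [Derivation.commutator_apply] at h
  exact sub_eq_zero.mp h

lemma tn_null {n : ℕ} (J : Ideal (MvPolynomial (Fin n) ℂ))
    (h : ∀ u, u ≠ 0 → ∃ p ∈ J, eval u p ≠ 0) : tnm 0 ≤ J.radical := by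
  rw [← MvPolynomial.vanishingIdeal_zeroLocus_eq_radical (K := ℂ)]
  intro p hp
  rw [tn_mem_m] at hp
  rw [mem_vanishingIdeal_iff]
  intro x hx
  rw [mem_zeroLocus_iff] at hx
  by_cases h0 : x = 0
  · rw [h0, aeval_eq_eval]; exact hp
  · obtain ⟨q, hq, hq'⟩ := h x h0
    exact absurd (by simpa [aeval_eq_eval] using hx q hq) hq'

lemma tn_dim (L : Type) [CommRing L] [IsLocalRing L] (J : Ideal L) (c d : ℕ)
    (h1 : ∀ Q : Ideal L, Q.IsPrime → J ≤ Q → Q ≠ maximalIdeal L → (c : ℕ∞) ≤ Q.height)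
    (h2 : (maximalIdeal L).height ≤ ((c + d : ℕ) : ℕ∞)) :
    ringKrullDim (L ⧸ J) ≤ d := by
  rw [ringKrullDim_quotient, Order.krullDim]
  refine iSup_le fun l => ?_
  rcases Nat.eq_zero_or_pos l.length with h0 | h0
  · rw [h0]; simp
  have key : ∀ i : ℕ, ∀ hi : i < l.length + 1,
      ((c + i : ℕ) : ℕ∞) ≤ (l ⟨i, hi⟩).1.asIdeal.height := by
    intro i
    induction i with
    | zero =>
      intro hi
      refine h1 _ (l ⟨0, hi⟩).1.2 (l ⟨0, hi⟩).2 ?_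
      intro hm
      have hlt : l ⟨0, hi⟩ < l ⟨1, by omega⟩ := l.strictMono (by rw [Fin.lt_def]; simp)
      have hlt' : (l ⟨0, hi⟩).1.asIdeal < (l ⟨1, by omega⟩).1.asIdeal := hlt
      rw [hm] at hlt'
      exact absurd (le_maximalIdeal (l ⟨1, by omega⟩).1.2.ne_top) (not_le_of_gt hlt')
    | succ i ih =>
      intro hi
      have hlt : l ⟨i, by omega⟩ < l ⟨i + 1, hi⟩ := l.strictMono (by rw [Fin.lt_def]; simp)
      have hlt' : (l ⟨i, by omega⟩).1.asIdeal < (l ⟨i + 1, hi⟩).1.asIdeal := hlt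
      have := (l ⟨i, by omega⟩).1.2
      have := (l ⟨i + 1, hi⟩).1.2
      refine le_trans ?_ (Ideal.height_add_one_le_of_lt_of_isPrime hlt')
      rw [← add_assoc, Nat.cast_add, Nat.cast_one]
      gcongr
      exact ih _
  have h3 := (key l.length (by omega)).trans ((Ideal.height_mono
    (le_maximalIdeal (l ⟨l.length, by omega⟩).1.2.ne_top)).trans h2)
  have h4 : c + l.length ≤ c + d := by exact_mod_cast h3
  have h5 : l.length ≤ d := by omega
  exact_mod_cast h5

/-- common hypotheses -/
structure TNHyp {n c : ℕ} (f : Fin c → MvPolynomial (Fin n) ℂ) : Prop where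
  hc : 1 ≤ c
  hn : c + 2 ≤ n
  h0 : ∀ i, eval 0 (f i) = 0
  h0' : ∀ i j, eval 0 (pderiv j (f i)) = 0
  hs : ∀ u, u ≠ 0 → (∀ i, eval u (f i) = 0) →
    LinearIndependent ℂ (fun i : Fin c => fun j : Fin n => eval u (pderiv j (f i)))

variable {n c : ℕ} {f : Fin c → MvPolynomial (Fin n) ℂ}

lemma tn_prime_max (L : Type) [CommRing L] [IsLocalRing L]
    [Algebra (MvPolynomial (Fin n) ℂ) L] [IsLocalization.AtPrime L (tnm (0 : Fin n → ℂ))]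
    (Q : Ideal L) [Q.IsPrime]
    (h : ∀ u, u ≠ 0 → ∃ p : MvPolynomial (Fin n) ℂ, algebraMap _ L p ∈ Q ∧ eval u p ≠ 0) :
    Q = maximalIdeal L := by
  refine le_antisymm (le_maximalIdeal (Ideal.IsPrime.ne_top ‹_›)) ?_
  rw [← IsLocalization.AtPrime.map_eq_maximalIdeal (tnm (0 : Fin n → ℂ)) L,
    Ideal.map_le_iff_le_comap]
  have := tn_null (Q.comap (algebraMap _ L)) h
  rwa [Ideal.IsPrime.radical] at this
  infer_instance

lemma tn_dimL (hf : TNHyp f) (L : Type) [CommRing L] [IsLocalRing L] [IsNoetherianRing L]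
    [Algebra (MvPolynomial (Fin n) ℂ) L] [IsLocalization.AtPrime L (tnm (0 : Fin n → ℂ))]
    (J : Ideal L) (hJ : (Ideal.span (Set.range f)).map (algebraMap _ L) ≤ J) (d : ℕ)
    (hd : c + d = n) : ringKrullDim (L ⧸ J) ≤ d := by
  refine tn_dim L J c d ?_ ?_
  · intro Q hQ hJQ hQm
    have : ∃ u, u ≠ 0 ∧ ∀ p : MvPolynomial (Fin n) ℂ, algebraMap _ L p ∈ Q → eval u p = 0 := by
      by_contra! h
      exact hQm (tn_prime_max L Q h)
    obtain ⟨u, hu, hu'⟩ := this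
    rw [← IsLocalization.height_under (tnm (0 : Fin n → ℂ)).primeCompl Q]
    have hle : Ideal.span (Set.range f) ≤ Q.under (MvPolynomial (Fin n) ℂ) :=
      Ideal.map_le_iff_le_comap.mp (hJ.trans hJQ)
    have hfu : ∀ i, eval u (f i) = 0 := fun i =>
      hu' _ (hle (Ideal.subset_span ⟨i, rfl⟩))
    exact tn_La u f hfu (hf.hs u hu hfu) _ hle (fun p hp => (tn_mem_m u p).mpr (hu' p hp))
  · have h1 : ((maximalIdeal L).height : WithBot ℕ∞) ≤ n := by
      rw [← IsLocalization.height_under (tnm (0 : Fin n → ℂ)).primeCompl (maximalIdeal L)]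
      have h2 : ringKrullDim (MvPolynomial (Fin n) ℂ) = n := by
        rw [MvPolynomial.ringKrullDim_of_isNoetherianRing, ringKrullDim_eq_zero_of_field]
        simp
      rw [← h2]
      refine Ideal.height_le_ringKrullDim_of_ne_top ?_
      exact Ideal.IsPrime.ne_top inferInstance
    rw [hd]
    exact_mod_cast h1

lemma tn_two (hf : TNHyp f) (L : Type) [CommRing L] [IsLocalRing L] [IsNoetherianRing L]
    [Algebra (MvPolynomial (Fin n) ℂ) L] [IsLocalization.AtPrime L (tnm (0 : Fin n → ℂ))]
    (P : Ideal L) (hP : P ≤ maximalIdeal L)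
    (hP' : ∀ Q : Ideal L, Q.IsPrime → P ≤ Q → Q = maximalIdeal L) :
    ∃ a b, a ∈ P ∧ b ∈ P ∧
      (∀ z, a * z ∈ (Ideal.span (Set.range f)).map (algebraMap _ L) →
        z ∈ (Ideal.span (Set.range f)).map (algebraMap _ L)) ∧
      (∀ z, b * z ∈ (Ideal.span (Set.range f)).map (algebraMap _ L) ⊔ Ideal.span {a} →
        z ∈ (Ideal.span (Set.range f)).map (algebraMap _ L) ⊔ Ideal.span {a}) := by
  obtain ⟨e, he⟩ := Nat.exists_eq_add_of_le hf.hn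
  let as := (List.ofFn f).map (algebraMap _ L)
  have e1 : (Ideal.span (Set.range f)).map (algebraMap _ L) = Ideal.ofList as := by
    rw [← Ideal.map_ofList, Ideal.ofList]
    congr 2
    ext; simp [List.mem_ofFn]
  have hasm : ∀ r ∈ as, r ∈ maximalIdeal L := by
    intro r hr
    simp only [as, List.mem_map, List.mem_ofFn] at hr
    obtain ⟨_, ⟨i, rfl⟩, rfl⟩ := hr
    rw [IsLocalization.AtPrime.to_map_mem_maximal_iff L (tnm (0 : Fin n → ℂ)), tn_mem_m]
    exact hf.h0 i
  have hG := tn_G L as L (2 + e) hasm (by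
      have := tn_depth_L (0 : Fin n → ℂ) L
      convert this using 1
      simp only [as, List.length_map, List.length_ofFn]
      omega) (by
      intro J _ _ hJ
      rw [← e1] at hJ
      exact tn_dimL hf L J hJ (2 + e) (by omega))
  have hle : Ideal.ofList as ≤ maximalIdeal L := Ideal.span_le.mpr hasm
  have hnt : Nontrivial (L ⧸ (Ideal.ofList as • ⊤ : Submodule L L)) :=
    Submodule.Quotient.nontrivial_iff.mpr (tn_smul_lt L L _ hle).ne
  obtain ⟨rs, h1, h2, h3⟩ := tn_depth_ideal L _ P hP hP' _ hG.2
  match rs, h1 with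
  | [], h1 => simp at h1; omega
  | [_], h1 => simp at h1; omega
  | a :: b :: rs, _ =>
    have hw : IsWeaklyRegular L (as ++ (a :: b :: rs)) :=
      (isWeaklyRegular_append_iff L _ _).mpr ⟨hG.1, h3.toIsWeaklyRegular⟩
    have hw' : IsWeaklyRegular L ((as ++ [a]) ++ (b :: rs)) := by simpa using hw
    refine ⟨a, b, h2 a (by simp), h2 b (by simp), ?_, ?_⟩
    · rw [e1]
      have := ((isWeaklyRegular_append_iff L _ _).mp hw).2
      rw [isWeaklyRegular_cons_iff] at this
      exact tn_reg_iff L _ a this.1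
    · have := ((isWeaklyRegular_append_iff L _ _).mp hw').2
      rw [isWeaklyRegular_cons_iff] at this
      have h := tn_reg_iff L _ b this.1
      rw [Ideal.ofList_append, Ideal.ofList_singleton, ← e1] at h
      exact h

lemma tn_F (hf : TNHyp f) (L : Type) [CommRing L] [IsLocalRing L] [IsNoetherianRing L]
    [Algebra (MvPolynomial (Fin n) ℂ) L] [IsLocalization.AtPrime L (tnm (0 : Fin n → ℂ))]
    (g : MvPolynomial (Fin n) ℂ) (hg : ∀ u, (∀ i, eval u (f i) = 0) → eval u g = 0) :
    algebraMap _ L g ∈ (Ideal.span (Set.range f)).map (algebraMap _ L) := by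
  obtain ⟨a, -, ha, -, hreg, -⟩ := tn_two hf L (maximalIdeal L) le_rfl (by
    intro Q hQ hle
    exact le_antisymm (le_maximalIdeal hQ.ne_top) hle)
  have hrad : g ∈ (Ideal.span (Set.range f)).radical := by
    rw [← MvPolynomial.vanishingIdeal_zeroLocus_eq_radical (K := ℂ), mem_vanishingIdeal_iff]
    intro u hu
    rw [aeval_eq_eval]
    refine hg u fun i => ?_
    have := hu (f i) (Ideal.subset_span ⟨i, rfl⟩)
    simpa [aeval_eq_eval] using this
  obtain ⟨e, he⟩ := hrad
  let K : Ideal (MvPolynomial (Fin n) ℂ) := (Ideal.span (Set.range f)).colon {g}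
  have hK : ∀ p, p ∈ K ↔ p * g ∈ Ideal.span (Set.range f) := fun p => by
    simp only [K, Submodule.mem_colon_singleton, smul_eq_mul]
  have h1 : tnm 0 ≤ K.radical := by
    apply tn_null
    intro u hu
    by_cases hfu : ∀ i, eval u (f i) = 0
    · obtain ⟨s, hs, hs'⟩ := tn_Lb u f hfu (hf.hs u hu hfu) g e he
      exact ⟨s, (hK s).mpr hs', hs⟩
    · push Not at hfu
      obtain ⟨i, hi⟩ := hfu
      exact ⟨f i, (hK _).mpr (Ideal.mul_mem_right _ _ (Ideal.subset_span ⟨i, rfl⟩)), hi⟩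
  have h2 : maximalIdeal L ≤ (K.map (algebraMap _ L)).radical := by
    rw [← IsLocalization.AtPrime.map_eq_maximalIdeal (tnm (0 : Fin n → ℂ)) L]
    exact (Ideal.map_mono h1).trans (Ideal.map_radical_le _)
  obtain ⟨k, hk⟩ := h2 ha
  have h3 : K.map (algebraMap _ L) ≤
      ((Ideal.span (Set.range f)).map (algebraMap _ L)).colon {algebraMap _ L g} := by
    rw [Ideal.map_le_iff_le_comap]
    intro p hp
    rw [Ideal.mem_comap, Submodule.mem_colon_singleton, smul_eq_mul, ← map_mul]
    exact Ideal.mem_map_of_mem _ ((hK p).mp hp)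
  have h4 := h3 hk
  rw [Submodule.mem_colon_singleton, smul_eq_mul] at h4
  clear hk
  induction k with
  | zero => simpa using h4
  | succ k ih =>
    apply ih
    apply hreg
    rw [← mul_assoc, ← pow_succ']
    exact h4

lemma tn_abs (R : Type) [CommRing R] {ι : Type} {c n : ℕ} (Δ : ι → R) (g : ι → Fin c → R)
    (ω : Fin n → R) (D : Fin c → Fin n → R)
    (h1 : ∀ J K i, Δ J * g K i = Δ K * g J i) (h2 : ∀ J j, Δ J * ω j = ∑ i, g J i * D i j)
    (a b : R) (ha : a ∈ Ideal.span (Set.range Δ)) (hb : b ∈ Ideal.span (Set.range Δ))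
    (hra : ∀ z, a * z = 0 → z = 0) (hrb : ∀ z, b * z ∈ Ideal.span {a} → z ∈ Ideal.span {a}) :
    ∃ h : Fin c → R, ∀ j, ω j = ∑ i, h i * D i j := by
  obtain ⟨α, hα⟩ := Finsupp.mem_ideal_span_range_iff_exists_finsupp.mp ha
  obtain ⟨β, hβ⟩ := Finsupp.mem_ideal_span_range_iff_exists_finsupp.mp hb
  rw [Finsupp.sum] at hα hβ
  have e1 : ∀ K i, a * g K i = Δ K * ∑ J ∈ α.support, α J * g J i := by
    intro K i
    rw [← hα, Finset.sum_mul, Finset.mul_sum]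
    refine Finset.sum_congr rfl fun J _ => ?_
    rw [mul_assoc, h1 J K i]; ring
  have e2 : ∀ i, b * ∑ J ∈ α.support, α J * g J i = a * ∑ J ∈ β.support, β J * g J i := by
    intro i
    rw [← hβ, Finset.sum_mul, Finset.mul_sum]
    refine Finset.sum_congr rfl fun K _ => ?_
    rw [mul_assoc, ← e1 K i]; ring
  have e3 : ∀ i, ∃ h, a * h = ∑ J ∈ α.support, α J * g J i := by
    intro i
    have := hrb (∑ J ∈ α.support, α J * g J i) (by
      rw [e2]; exact Ideal.mul_mem_right _ _ (Ideal.mem_span_singleton_self a))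
    obtain ⟨h, hh⟩ := Ideal.mem_span_singleton'.mp this
    exact ⟨h, by rw [← hh, mul_comm]⟩
  choose h hh using e3
  refine ⟨h, fun j => ?_⟩
  rw [← sub_eq_zero]
  apply hra
  rw [mul_sub, sub_eq_zero, Finset.mul_sum]
  have e4 : a * ω j = ∑ i, (∑ J ∈ α.support, α J * g J i) * D i j := by
    rw [← hα, Finset.sum_mul]
    simp_rw [Finset.sum_mul]
    rw [Finset.sum_comm]
    refine Finset.sum_congr rfl fun J _ => ?_
    rw [mul_assoc, h2 J j, Finset.mul_sum]
    exact Finset.sum_congr rfl fun i _ => by ring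
  rw [e4]
  refine Finset.sum_congr rfl fun i _ => ?_
  rw [← hh i]; ring

end TNMain

section TNFin
open RingTheory.Sequence IsLocalRing Matrix

variable {n c : ℕ} {f : Fin c → MvPolynomial (Fin n) ℂ}

/-- Jacobian -/
noncomputable def tnJ (f : Fin c → MvPolynomial (Fin n) ℂ) :
    Matrix (Fin c) (Fin n) (MvPolynomial (Fin n) ℂ) := Matrix.of fun i j => pderiv j (f i)

/-- Jacobian at a point -/
noncomputable def tnJu (f : Fin c → MvPolynomial (Fin n) ℂ) (u : Fin n → ℂ) :
    Matrix (Fin c) (Fin n) ℂ := Matrix.of fun i j => eval u (pderiv j (f i))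

/-- constant matrix -/
noncomputable def tnB (B : Matrix (Fin n) (Fin c) ℂ) :
    Matrix (Fin n) (Fin c) (MvPolynomial (Fin n) ℂ) := Matrix.of fun i j => C (B i j)

lemma tnB_ev (u : Fin n → ℂ) (B : Matrix (Fin n) (Fin c) ℂ) : (tnB B).map (eval u) = B := by
  ext i j; simp [tnB]

lemma tnJ_ev (f : Fin c → MvPolynomial (Fin n) ℂ) (u : Fin n → ℂ) :
    (tnJ f).map (eval u) = tnJu f u := rfl

/-- minor -/
noncomputable def tnΔ (f : Fin c → MvPolynomial (Fin n) ℂ) (B : Matrix (Fin n) (Fin c) ℂ) :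
    MvPolynomial (Fin n) ℂ := (tnJ f * tnB B).det

/-- Cramer numerators -/
noncomputable def tng (f : Fin c → MvPolynomial (Fin n) ℂ) (ω : Fin n → MvPolynomial (Fin n) ℂ)
    (B : Matrix (Fin n) (Fin c) ℂ) : Fin c → MvPolynomial (Fin n) ℂ :=
  (ω ᵥ* tnB B) ᵥ* (tnJ f * tnB B).adjugate

lemma tn_ev (f : Fin c → MvPolynomial (Fin n) ℂ) (u : Fin n → ℂ) (B : Matrix (Fin n) (Fin c) ℂ) :
    (eval u).mapMatrix (tnJ f * tnB B) = tnJu f u * B := by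
  rw [RingHom.mapMatrix_apply, Matrix.map_mul, tnB_ev, tnJ_ev]

lemma tnΔ_ev (f : Fin c → MvPolynomial (Fin n) ℂ) (u : Fin n → ℂ) (B : Matrix (Fin n) (Fin c) ℂ) :
    eval u (tnΔ f B) = (tnJu f u * B).det := by
  rw [tnΔ, RingHom.map_det, tn_ev]

lemma tng_ev (f : Fin c → MvPolynomial (Fin n) ℂ) (ω : Fin n → MvPolynomial (Fin n) ℂ)
    (u : Fin n → ℂ) (B : Matrix (Fin n) (Fin c) ℂ) (l : Fin c → ℂ)
    (hl : ∀ j, eval u (ω j) = ∑ i, l i * eval u (pderiv j (f i))) (i : Fin c) :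
    eval u (tng f ω B i) = (tnJu f u * B).det * l i := by
  have h1 : (⇑(eval u) ∘ (ω ᵥ* tnB B)) = l ᵥ* (tnJu f u * B) := by
    ext j
    rw [Function.comp_apply, RingHom.map_vecMul]
    have : ⇑(eval u) ∘ ω = l ᵥ* tnJu f u := by
      ext j
      rw [Function.comp_apply, hl]; rfl
    rw [this, ← Matrix.vecMul_vecMul, tnB_ev]
  rw [tng, RingHom.map_vecMul, h1]
  have h2 : (tnJ f * tnB B).adjugate.map (eval u) = (tnJu f u * B).adjugate := by
    rw [← tn_ev, ← RingHom.map_adjugate]; rfl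
  rw [h2, Matrix.vecMul_vecMul, Matrix.mul_adjugate, Matrix.vecMul_smul, Matrix.vecMul_one]
  simp

lemma tn_rinv (u : Fin n → ℂ)
    (h : LinearIndependent ℂ (fun i : Fin c => fun j : Fin n => eval u (pderiv j (f i)))) :
    ∃ B : Matrix (Fin n) (Fin c) ℂ, tnJu f u * B = 1 := by
  have h1 : LinearIndependent ℂ (tnJu f u).row := h
  rw [← Matrix.vecMul_injective_iff] at h1
  obtain ⟨T, hT⟩ := LinearMap.exists_leftInverse_of_injective (Matrix.vecMulLinear (tnJu f u))
    (LinearMap.ker_eq_bot.mpr h1)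
  refine ⟨(LinearMap.toMatrix' T)ᵀ, ?_⟩
  rw [← Matrix.transpose_inj, Matrix.transpose_mul, Matrix.transpose_transpose,
    Matrix.transpose_one]
  apply Matrix.toLin'.injective
  rw [Matrix.toLin'_mul, Matrix.toLin'_toMatrix', Matrix.toLin'_one, ← hT]
  congr 1
  ext v j
  simp [Matrix.vecMul, Matrix.mulVec, dotProduct_comm]

lemma tn_abs2 (R : Type) [CommRing R] (I : Ideal R) {ι : Type} {c n : ℕ} (Δ : ι → R)
    (g : ι → Fin c → R) (ω : Fin n → R) (D : Fin c → Fin n → R)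
    (h1 : ∀ J K i, Δ J * g K i - Δ K * g J i ∈ I)
    (h2 : ∀ J j, Δ J * ω j - ∑ i, g J i * D i j ∈ I)
    (a b : R) (ha : a ∈ I ⊔ Ideal.span (Set.range Δ)) (hb : b ∈ I ⊔ Ideal.span (Set.range Δ))
    (hra : ∀ z, a * z ∈ I → z ∈ I)
    (hrb : ∀ z, b * z ∈ I ⊔ Ideal.span {a} → z ∈ I ⊔ Ideal.span {a}) :
    ∃ h : Fin c → R, ∀ j, ω j - ∑ i, h i * D i j ∈ I := by
  let q : R →+* R ⧸ I := Ideal.Quotient.mk I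
  have hq : ∀ x, q x = 0 ↔ x ∈ I := fun x => Ideal.Quotient.eq_zero_iff_mem
  have hmem : ∀ x ∈ I ⊔ Ideal.span (Set.range Δ), q x ∈ Ideal.span (Set.range fun B => q (Δ B)) := by
    intro x hx
    have h1 := Ideal.mem_map_of_mem q hx
    rw [Ideal.map_sup, Ideal.map_quotient_self, bot_sup_eq, Ideal.map_span, ← Set.range_comp] at h1
    exact h1
  have hker : ∀ x, q x ∈ Ideal.span {q a} ↔ x ∈ I ⊔ Ideal.span {a} := by
    intro x
    constructor
    · intro hx
      obtain ⟨y, hy⟩ := Ideal.mem_span_singleton'.mp hx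
      obtain ⟨y, rfl⟩ := Ideal.Quotient.mk_surjective y
      change q y * q a = q x at hy
      have h3 : x - y * a ∈ I := by
        rw [← hq, map_sub, map_mul, hy, sub_self]
      have : x = (x - y * a) + y * a := by ring
      rw [this]
      exact Submodule.add_mem_sup h3 (Ideal.mul_mem_left _ _ (Ideal.mem_span_singleton_self a))
    · intro hx
      have h1 := Ideal.mem_map_of_mem q hx
      rw [Ideal.map_sup, Ideal.map_quotient_self, bot_sup_eq, Ideal.map_span,
        Set.image_singleton] at h1
      exact h1
  obtain ⟨h, hh⟩ := tn_abs (R ⧸ I) (fun B => q (Δ B)) (fun B i => q (g B i))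
    (fun j => q (ω j)) (fun i j => q (D i j))
    (by
      intro J K i
      rw [← map_mul, ← map_mul, ← sub_eq_zero, ← map_sub, hq]
      exact h1 J K i)
    (by
      intro J j
      simp only [← map_mul, ← map_sum]
      rw [← sub_eq_zero, ← map_sub, hq]
      exact h2 J j)
    (q a) (q b) (hmem a ha) (hmem b hb)
    (by
      intro z hz
      obtain ⟨z, rfl⟩ := Ideal.Quotient.mk_surjective z
      change q z = 0
      change q a * q z = 0 at hz
      rw [← map_mul, hq] at hz
      rw [hq]
      exact hra z hz)
    (by
      intro z hz
      obtain ⟨z, rfl⟩ := Ideal.Quotient.mk_surjective z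
      change q z ∈ _
      change q b * q z ∈ _ at hz
      rw [← map_mul, hker] at hz
      rw [hker]
      exact hrb z hz)
  have hlift : ∀ i, ∃ y : R, q y = h i := fun i => Ideal.Quotient.mk_surjective (h i)
  choose y hy using hlift
  refine ⟨y, fun j => ?_⟩
  rw [← hq, map_sub, map_sum, sub_eq_zero]
  simp only [map_mul, hy]
  exact hh j

lemma tn_H0 (hf : TNHyp f) (L : Type) [CommRing L] [IsLocalRing L] [IsNoetherianRing L]
    [Algebra (MvPolynomial (Fin n) ℂ) L] [IsLocalization.AtPrime L (tnm (0 : Fin n → ℂ))]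
    (ω : Fin n → MvPolynomial (Fin n) ℂ)
    (hω : ∀ u, (∀ i, eval u (f i) = 0) →
      ∃ l : Fin c → ℂ, ∀ j, eval u (ω j) = ∑ i, l i * eval u (pderiv j (f i))) :
    ∃ h : Fin c → L, ∀ j, algebraMap (MvPolynomial (Fin n) ℂ) L (ω j) -
      ∑ i, h i * algebraMap (MvPolynomial (Fin n) ℂ) L (pderiv j (f i)) ∈
        (Ideal.span (Set.range f)).map (algebraMap (MvPolynomial (Fin n) ℂ) L) := by
  have hI : ∀ i, algebraMap _ L (f i) ∈ (Ideal.span (Set.range f)).map (algebraMap _ L) := fun i =>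
    Ideal.mem_map_of_mem _ (Ideal.subset_span ⟨i, rfl⟩)
  have hm : ∀ p : MvPolynomial (Fin n) ℂ, eval 0 p = 0 → algebraMap _ L p ∈ maximalIdeal L :=
    fun p hp =>
    (IsLocalization.AtPrime.to_map_mem_maximal_iff L (tnm (0 : Fin n → ℂ)) p).mpr
      ((tn_mem_m 0 p).mpr hp)
  have hP : (Ideal.span (Set.range f)).map (algebraMap _ L) ⊔
      Ideal.span (Set.range fun B => algebraMap _ L (tnΔ f B)) ≤ maximalIdeal L := by
    refine sup_le ?_ ?_
    · rw [Ideal.map_le_iff_le_comap, Ideal.span_le]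
      rintro _ ⟨i, rfl⟩
      exact hm _ (hf.h0 i)
    · rw [Ideal.span_le]
      rintro _ ⟨B, rfl⟩
      apply hm
      rw [tnΔ_ev]
      have : tnJu f 0 = 0 := by ext i j; exact hf.h0' i j
      have hne : Nonempty (Fin c) := ⟨⟨0, hf.hc⟩⟩
      rw [this, Matrix.zero_mul, Matrix.det_zero]
  obtain ⟨a, b, ha, hb, hra, hrb⟩ := tn_two hf L _ hP (by
    intro Q hQ hle
    apply tn_prime_max (n := n) L Q
    intro u hu
    by_cases hfu : ∀ i, eval u (f i) = 0
    · obtain ⟨B, hB⟩ := tn_rinv u (hf.hs u hu hfu)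
      refine ⟨tnΔ f B, hle (Ideal.mem_sup_right (Ideal.subset_span ⟨B, rfl⟩)), ?_⟩
      rw [tnΔ_ev, hB]; simp
    · push Not at hfu
      obtain ⟨i, hi⟩ := hfu
      exact ⟨f i, hle (Ideal.mem_sup_left (hI i)), hi⟩)
  refine tn_abs2 L _ (fun B => algebraMap _ L (tnΔ f B)) (fun B i => algebraMap _ L (tng f ω B i))
    (fun j => algebraMap _ L (ω j)) (fun i j => algebraMap _ L (pderiv j (f i)))
    ?_ ?_ a b ha hb hra hrb
  · intro J K i
    rw [← map_mul, ← map_mul, ← map_sub]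
    apply tn_F hf
    intro u hu
    obtain ⟨l, hl⟩ := hω u hu
    rw [map_sub, map_mul, map_mul, tng_ev f ω u _ l hl, tng_ev f ω u _ l hl, tnΔ_ev, tnΔ_ev]
    ring
  · intro J j
    simp only [← map_mul, ← map_sum, ← map_sub]
    apply tn_F hf
    intro u hu
    obtain ⟨l, hl⟩ := hω u hu
    simp only [map_sub, map_sum, map_mul, tng_ev f ω u _ l hl, tnΔ_ev]
    rw [hl, Finset.mul_sum, sub_eq_zero]
    exact Finset.sum_congr rfl fun i _ => by ring

lemma tn_H1 (L : Type) [CommRing L] [IsLocalRing L] [IsNoetherianRing L]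
    [Algebra (MvPolynomial (Fin n) ℂ) L] [IsLocalization.AtPrime L (tnm (0 : Fin n → ℂ))]
    (ω : Fin n → MvPolynomial (Fin n) ℂ) (y : Fin c → L)
    (hy : ∀ j, algebraMap (MvPolynomial (Fin n) ℂ) L (ω j) -
      ∑ i, y i * algebraMap (MvPolynomial (Fin n) ℂ) L (pderiv j (f i)) ∈
        (Ideal.span (Set.range f)).map (algebraMap (MvPolynomial (Fin n) ℂ) L)) :
    ∃ (s : MvPolynomial (Fin n) ℂ) (H : Fin c → MvPolynomial (Fin n) ℂ), eval 0 s ≠ 0 ∧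
      ∀ j, s * ω j - ∑ i, H i * pderiv j (f i) ∈ Ideal.span (Set.range f) := by
  obtain ⟨t, ht⟩ := IsLocalization.exist_integer_multiples_of_finite
    (tnm (0 : Fin n → ℂ)).primeCompl y
  choose H' hH' using ht
  have key : ∀ j, ∃ s : MvPolynomial (Fin n) ℂ, s ∉ tnm 0 ∧
      s * ((t : MvPolynomial (Fin n) ℂ) * ω j - ∑ i, H' i * pderiv j (f i)) ∈
        Ideal.span (Set.range f) := by
    intro j
    have h1 : algebraMap _ L ((t : MvPolynomial (Fin n) ℂ) * ω j - ∑ i, H' i * pderiv j (f i)) ∈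
        (Ideal.span (Set.range f)).map (algebraMap (MvPolynomial (Fin n) ℂ) L) := by
      convert Ideal.mul_mem_left _ (algebraMap _ L (t : MvPolynomial (Fin n) ℂ)) (hy j) using 1
      simp only [map_sub, map_mul, map_sum, hH', Algebra.smul_def, mul_sub, Finset.mul_sum,
        mul_assoc]
    obtain ⟨s, hs, hs'⟩ := (IsLocalization.algebraMap_mem_map_algebraMap_iff
      (tnm (0 : Fin n → ℂ)).primeCompl L _ _).mp h1
    exact ⟨s, hs, hs'⟩
  choose s hs hs' using key
  refine ⟨(∏ j, s j) * t, fun i => (∏ j, s j) * H' i, ?_, ?_⟩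
  · rw [map_mul, map_prod]
    refine mul_ne_zero (Finset.prod_ne_zero_iff.mpr fun j _ => ?_) ?_
    · exact fun h => hs j ((tn_mem_m 0 _).mpr h)
    · exact fun h => t.2 ((tn_mem_m 0 _).mpr h)
  · intro j
    have e : (∏ j, s j) * (t : MvPolynomial (Fin n) ℂ) * ω j -
          ∑ i, (∏ j, s j) * H' i * pderiv j (f i) =
        (∏ k ∈ Finset.univ.erase j, s k) *
          (s j * ((t : MvPolynomial (Fin n) ℂ) * ω j - ∑ i, H' i * pderiv j (f i))) := by
      rw [← mul_assoc, Finset.prod_erase_mul _ _ (Finset.mem_univ j), mul_sub, Finset.mul_sum]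
      simp only [mul_assoc]
    rw [e]
    exact Ideal.mul_mem_left _ _ (hs' j)

lemma tn_H (hf : TNHyp f) (ω : Fin n → MvPolynomial (Fin n) ℂ)
    (hω : ∀ u, (∀ i, eval u (f i) = 0) →
      ∃ l : Fin c → ℂ, ∀ j, eval u (ω j) = ∑ i, l i * eval u (pderiv j (f i))) :
    ∃ (s : MvPolynomial (Fin n) ℂ) (H : Fin c → MvPolynomial (Fin n) ℂ), eval 0 s ≠ 0 ∧
      ∀ j, s * ω j - ∑ i, H i * pderiv j (f i) ∈ Ideal.span (Set.range f) := by
  obtain ⟨y, hy⟩ := tn_H0 hf (Localization.AtPrime (tnm (0 : Fin n → ℂ))) ω hω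
  exact tn_H1 _ ω y hy

lemma tn_sym (hf : TNHyp f) (a : Fin n → Fin n → ℂ) (ha : ∀ j k, a j k = - a k j)
    (hω : ∀ u, (∀ i, eval u (f i) = 0) →
      ∃ l : Fin c → ℂ, ∀ j, ∑ k, a k j * u k = ∑ i, l i * eval u (pderiv j (f i))) : a = 0 := by
  classical
  let ω : Fin n → MvPolynomial (Fin n) ℂ := fun j => ∑ k, C (a k j) * X k
  obtain ⟨s, H, hs, hH⟩ := tn_H hf ω (by
    intro u hu
    obtain ⟨l, hl⟩ := hω u hu
    refine ⟨l, fun j => ?_⟩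
    rw [← hl]
    simp [ω])
  have hI : ∀ p ∈ Ideal.span (Set.range f), ∀ k, eval 0 (pderiv k p) = 0 := by
    intro p hp k
    obtain ⟨r, rfl⟩ := Ideal.mem_span_range_iff_exists_fun.mp hp
    simp only [map_sum, Derivation.leibniz, smul_eq_mul, map_add, map_mul, hf.h0, hf.h0', zero_mul,
      mul_zero, add_zero, Finset.sum_const_zero]
  have key : ∀ j k, eval 0 s * a k j = ∑ i, eval 0 (H i) * eval 0 (pderiv k (pderiv j (f i))) := by
    intro j k
    have h1 := hI _ (hH j) k
    have h2 : eval 0 (ω j) = 0 := by simp [ω]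
    have h3 : eval 0 (pderiv k (ω j)) = a k j := by
      simp [ω, Derivation.leibniz, pderiv_X, Pi.single_apply]
    simp only [map_sub, map_sum, Derivation.leibniz, smul_eq_mul, map_add, map_mul, h2, h3,
      hf.h0', zero_mul, mul_zero, add_zero] at h1
    exact sub_eq_zero.mp h1
  ext j k
  have h1 := key k j
  have h2 := key j k
  simp_rw [tn_pderiv_comm k j] at h2
  rw [← h1] at h2
  have h3 := mul_left_cancel₀ hs h2
  have h4 := ha j k
  rw [h3] at h4
  exact self_eq_neg.mp h4

end TNFin

section TNEnd

lemma tn_hom0 {n d : ℕ} (p : MvPolynomial (Fin n) ℂ) (hp : p.IsHomogeneous d) (hd : d ≠ 0) :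
    eval 0 p = 0 := by
  have : eval 0 p = constantCoeff p := by
    simp
  rw [this, constantCoeff_eq]
  exact hp.coeff_eq_zero (by simpa using hd.symm)

lemma tn_hom_const {n : ℕ} (p : MvPolynomial (Fin n) ℂ) (hp : p.IsHomogeneous 0) :
    ∃ a, p = C a :=
  ⟨_, totalDegree_eq_zero_iff_eq_C.mp (Nat.le_zero.mp hp.totalDegree_le)⟩

end TNEnd

/-- Let `Z ⊂ ℙV` (here `ℙV = ℙ^N`, `V = ℂ^{N+1}`) be a
positive-dimensional nonsingular nondegenerate complete intersection, cut out by
homogeneous polynomials `f₁, …, f_c`, with affine cone `Ẑ` and affine tangent spaces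
`T_u(Ẑ) = {v : Σⱼ ∂f_i/∂x_j(u) v_j = 0 ∀ i}` at smooth points.  Then `Z` is tangentially
nondegenerate: if `A ∈ Hom(Λ²V, V)` satisfies `A(u,v) = 0` for every `u ∈ Ẑ` and every
`v ∈ T_u(Ẑ)`, then `A = 0`. -/
theorem stmt6 (N c : ℕ) (hc : 1 ≤ c) (hdim : c < N)  -- positive dimension: `dim Z = N - c ≥ 1`
    (f : Fin c → MvPolynomial (Fin (N + 1)) ℂ)
    (m : Fin c → ℕ) (hf : ∀ i, (f i).IsHomogeneous (m i))
    (Zhat : Set (Fin (N + 1) → ℂ))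
    (hZ : Zhat = {u | ∀ i, eval u (f i) = 0})  -- the affine cone of `Z`
    -- nonsingularity of `Z`, and `Z` is a complete intersection of codimension `c`:
    (hsmooth : ∀ u ∈ Zhat, u ≠ 0 →
      LinearIndependent ℂ (fun i : Fin c => fun j : Fin (N + 1) => eval u (pderiv j (f i))))
    -- nondegeneracy: `Z` lies in no hyperplane, i.e. `Ẑ` spans `V`:
    (hnondeg : Submodule.span ℂ Zhat = ⊤)
    (A : (Fin (N + 1) → ℂ) →ₗ[ℂ] (Fin (N + 1) → ℂ) →ₗ[ℂ] (Fin (N + 1) → ℂ))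
    (hAalt : ∀ u v, A u v = - A v u)
    (hA : ∀ u ∈ Zhat, u ≠ 0 → ∀ v : Fin (N + 1) → ℂ,
      (∀ i, ∑ j, eval u (pderiv j (f i)) * v j = 0) → A u v = 0) :
    A = 0 := by
  classical
  subst hZ
  obtain ⟨u₀, hu₀, hu₀'⟩ : ∃ u ∈ {u | ∀ i, eval u (f i) = 0}, u ≠ 0 := by
    by_contra! h
    have h1 : Submodule.span ℂ {u | ∀ i, eval u (f i) = 0} ≤ ⊥ := by
      rw [Submodule.span_le]
      intro u hu
      simpa using h u hu
    rw [hnondeg] at h1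
    exact bot_ne_top (le_antisymm bot_le h1)
  have hm : ∀ i, 2 ≤ m i := by
    intro i
    by_contra! hlt
    have hne := (hsmooth u₀ hu₀ hu₀').ne_zero i
    have hi := hf i
    apply hne
    interval_cases hmi : m i
    · obtain ⟨a, ha⟩ := tn_hom_const _ hi
      funext j
      simp [ha]
    · have hd : ∀ j, ∃ a, pderiv j (f i) = C a := fun j => tn_hom_const _ hi.pderiv
      choose a ha using hd
      have hE : ∀ v, eval v (f i) = ∑ j, v j * a j := by
        intro v
        have := congrArg (eval v) hi.sum_X_mul_pderiv
        simp only [map_sum, map_mul, eval_X, ha, eval_C, one_smul] at this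
        exact this.symm
      have hz : ∀ v : Fin (N + 1) → ℂ, ∑ j, v j * a j = 0 := by
        intro v
        have hv : v ∈ Submodule.span ℂ {u | ∀ i, eval u (f i) = 0} := by rw [hnondeg]; trivial
        induction hv using Submodule.span_induction with
        | mem x hx => rw [← hE]; exact hx i
        | zero => simp
        | add x y _ _ hx hy => simp [add_mul, Finset.sum_add_distrib, hx, hy]
        | smul r x _ hx => simp [mul_assoc, ← Finset.mul_sum, hx]
      funext j
      have := hz (Pi.single j 1)
      simpa [ha, Pi.single_apply] using this
  have H : TNHyp f :=
    { hc := hc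
      hn := by omega
      h0 := fun i => tn_hom0 _ (hf i) (by have := hm i; omega)
      h0' := fun i j => tn_hom0 _ (hf i).pderiv (by have := hm i; omega)
      hs := fun u hu hu' => hsmooth u hu' hu }
  have key : ∀ q : Fin (N + 1),
      (fun k j => A (Pi.single k 1) (Pi.single j 1) q : Fin (N + 1) → Fin (N + 1) → ℂ) = 0 := by
    intro q
    refine tn_sym H _ ?_ ?_
    · intro j k
      rw [hAalt]; rfl
    · intro u hu
      by_cases hu0 : u = 0
      · exact ⟨0, fun j => by simp [hu0]⟩
      obtain ⟨B, hB⟩ := tn_rinv u (hsmooth u hu hu0)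
      refine ⟨fun i => A u (fun k => B k i) q, fun j => ?_⟩
      have e1 : ∑ k, A (Pi.single k 1) (Pi.single j 1) q * u k = A u (Pi.single j 1) q := by
        have e0 : u = ∑ k, u k • (Pi.single k 1 : Fin (N + 1) → ℂ) := pi_eq_sum_univ' u
        conv_rhs => rw [e0]
        simp only [map_sum, map_smul, LinearMap.sum_apply, LinearMap.smul_apply, Finset.sum_apply,
          Pi.smul_apply, smul_eq_mul]
        exact Finset.sum_congr rfl fun i _ => mul_comm _ _
      rw [e1]
      have e2 := hA u hu hu0 (Pi.single j 1 - ∑ i, tnJu f u i j • (fun k => B k i)) (by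
        intro i
        have h3 : ∀ i', ∑ k, tnJu f u i k * B k i' = (1 : Matrix (Fin c) (Fin c) ℂ) i i' := by
          intro i'; rw [← hB, Matrix.mul_apply]
        change ∑ k, tnJu f u i k * _ = 0
        simp only [Pi.sub_apply, Finset.sum_apply, Pi.smul_apply, smul_eq_mul, mul_sub,
          Finset.sum_sub_distrib, Finset.mul_sum]
        rw [Finset.sum_comm]
        simp only [mul_left_comm _ (tnJu f u _ j), ← Finset.mul_sum, h3]
        simp [Matrix.one_apply, Pi.single_apply])
      rw [map_sub, sub_eq_zero] at e2
      rw [e2]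
      simp only [map_sum, map_smul, Finset.sum_apply, Pi.smul_apply, smul_eq_mul]
      exact Finset.sum_congr rfl fun i _ => mul_comm _ _
  refine (Pi.basisFun ℂ (Fin (N + 1))).ext fun k => (Pi.basisFun ℂ (Fin (N + 1))).ext fun j => ?_
  funext q
  have := congrFun (congrFun (key q) k) j
  simpa using this
end

section
/- Let Z ⊂ ℙV be a positive-dimensional nonsingular nondegenerate complete intersection of positive codimension that is not a plane conic, such that dim H⁰(Z, T_Z ⊗ Ω_Z ⊗ O_Z(1)) = dim V. Then Ξ_Z = Ξ_V, i.e., every σ ∈ Hom(Λ²V,V) with σ(u,v) ∈ T_u(Ẑ) for all u ∈ Ẑ and v ∈ T_u(Ẑ) satisfies σ(u,v) ∈ ℂu + ℂv for all u, v ∈ V. -/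
section partA
open RingTheory.Sequence

lemma wr_snoc {R : Type*} [CommRing R] (rs : List R) (b : R) :
    IsWeaklyRegular R (rs ++ [b]) ↔ IsWeaklyRegular R rs ∧
      ∀ z, b * z ∈ Ideal.ofList rs → z ∈ Ideal.ofList rs := by
  rw [isWeaklyRegular_append_iff, isWeaklyRegular_singleton_iff,
    isSMulRegular_iff_right_eq_zero_of_smul]
  refine and_congr_right fun _ => ?_
  constructor
  · intro h z hz
    have := h (Submodule.Quotient.mk z) (by
      rw [← Submodule.Quotient.mk_smul, Submodule.Quotient.mk_eq_zero]
      simpa using hz)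
    rw [Submodule.Quotient.mk_eq_zero] at this
    simpa using this
  · intro h z
    obtain ⟨z, rfl⟩ := Submodule.Quotient.mk_surjective _ z
    intro hz
    rw [← Submodule.Quotient.mk_smul, Submodule.Quotient.mk_eq_zero] at hz
    rw [Submodule.Quotient.mk_eq_zero]
    simpa using h z (by simpa using hz)

def Prim {R : Type*} [CommRing R] [IsLocalRing R] (I : Ideal R) : Prop :=
  ∀ Q : Ideal R, Q.IsPrime → I ≤ Q → IsLocalRing.maximalIdeal R ≤ Q

lemma Prim.pow_mem {R : Type*} [CommRing R] [IsLocalRing R] {I : Ideal R} (h : Prim I)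
    {b : R} (hb : b ∈ IsLocalRing.maximalIdeal R) : ∃ k, b ^ k ∈ I := by
  have : b ∈ I.radical := by
    rw [Ideal.radical_eq_sInf, Ideal.mem_sInf]
    rintro Q ⟨h1, h2⟩
    exact h Q h2 h1 hb
  exact this

lemma exchange {R : Type*} [CommRing R] [IsLocalRing R] (rs : List R) (b c : R)
    (h : IsWeaklyRegular R (rs ++ [b])) (hb : b ∈ IsLocalRing.maximalIdeal R)
    (hp : Prim (Ideal.ofList (rs ++ [c]))) : IsWeaklyRegular R (rs ++ [c]) := by
  rw [wr_snoc] at h ⊢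
  refine ⟨h.1, fun z hz => ?_⟩
  obtain ⟨k, hk⟩ := hp.pow_mem hb
  have key : ∀ k, b ^ k * z ∈ Ideal.ofList rs → z ∈ Ideal.ofList rs := by
    intro k
    induction k with
    | zero => simp
    | succ k ih =>
      intro hh
      exact ih (h.2 _ (by rwa [← mul_assoc, ← pow_succ']))
  apply key k
  rw [Ideal.ofList_append, Ideal.ofList_singleton, Submodule.mem_sup] at hk
  obtain ⟨y, hy, w, hw, e⟩ := hk
  obtain ⟨t, rfl⟩ := Ideal.mem_span_singleton'.mp hw
  rw [← e, add_mul]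
  refine add_mem (Ideal.mul_mem_right _ _ hy) ?_
  rw [mul_assoc]
  exact Ideal.mul_mem_left _ _ hz

lemma prim_of_avoid {R : Type*} [CommRing R] [IsLocalRing R] [IsNoetherianRing R]
    (A : Ideal R) (h l : R) (hh : h ∈ IsLocalRing.maximalIdeal R)
    (hp : Prim (A ⊔ Ideal.span {h}))
    (hl : ∀ P ∈ A.minimalPrimes, P ≠ IsLocalRing.maximalIdeal R → l ∉ P) :
    Prim (A ⊔ Ideal.span {l}) := by
  intro Q hQ hle
  obtain ⟨P, hP, hPQ⟩ := Ideal.exists_minimalPrimes_le (le_sup_left.trans hle)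
  have hPp : P.IsPrime := hP.1.1
  by_cases hPm : P = IsLocalRing.maximalIdeal R
  · rwa [← hPm]
  have hlP := hl P hP hPm
  have hlQ : l ∈ Q := hle (Ideal.mem_sup_right (Ideal.mem_span_singleton_self l))
  have hPm' : P ≤ IsLocalRing.maximalIdeal R := IsLocalRing.le_maximalIdeal hPp.ne_top
  have hQm' : Q ≤ IsLocalRing.maximalIdeal R := IsLocalRing.le_maximalIdeal hQ.ne_top
  by_contra hcon
  have hmin : IsLocalRing.maximalIdeal R ∈ (P ⊔ Ideal.span {h}).minimalPrimes := by
    refine ⟨⟨inferInstance, sup_le hPm' ((Ideal.span_singleton_le_iff_mem _).2 hh)⟩, ?_⟩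
    rintro T ⟨hT, hT2⟩ _
    exact hp T hT ((sup_le_sup_right hP.1.2 _).trans hT2)
  have hht := Ideal.map_height_le_one_of_mem_minimalPrimes hmin
  set π := Ideal.Quotient.mk P
  have hker : RingHom.ker π = P := Ideal.mk_ker
  have hc : ∀ T : Ideal R, P ≤ T → (T.map π).comap π = T := by
    intro T hT
    rw [Ideal.comap_map_of_surjective _ Ideal.Quotient.mk_surjective]
    refine sup_eq_left.2 (le_trans (le_of_eq ?_) hT)
    exact hker
  have p1 : (Q.map π).IsPrime :=
    Ideal.map_isPrime_of_surjective Ideal.Quotient.mk_surjective (hker.trans_le hPQ)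
  have p2 : ((IsLocalRing.maximalIdeal R).map π).IsPrime :=
    Ideal.map_isPrime_of_surjective Ideal.Quotient.mk_surjective (hker.trans_le hPm')
  have lt1 : (⊥ : Ideal (R ⧸ P)) < Q.map π := by
    rw [bot_lt_iff_ne_bot]
    intro e
    apply hlP
    have : l ∈ (Q.map π).comap π := by rw [hc Q hPQ]; exact hlQ
    rw [e] at this
    rw [← hker]; exact this
  have lt2 : Q.map π < (IsLocalRing.maximalIdeal R).map π := by
    refine lt_of_le_of_ne (Ideal.map_mono hQm') fun e => hcon ?_
    rw [← hc Q hPQ, e, hc _ hPm']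
  have h1 := Ideal.height_add_one_le_of_lt_of_isPrime lt2
  have h0 := Ideal.height_add_one_le_of_lt_of_isPrime lt1
  have h2 := h1.trans hht
  have h3 : (1 : ℕ∞) ≤ (Q.map π).height := le_trans (by simp) h0
  have h4 : (1 : ℕ∞) + 1 ≤ 1 := le_trans (add_le_add_left h3 1) h2
  exact absurd h4 (by decide)

lemma exists_two {R : Type*} [CommRing R] [IsLocalRing R] [IsNoetherianRing R]
    (A B : Ideal R) (h x : R) (hh : h ∈ IsLocalRing.maximalIdeal R)
    (hx : x ∈ IsLocalRing.maximalIdeal R)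
    (hp : Prim (A ⊔ Ideal.span {h})) (hq : Prim (B ⊔ Ideal.span {x})) :
    ∃ l ∈ IsLocalRing.maximalIdeal R, Prim (A ⊔ Ideal.span {l}) ∧ Prim (B ⊔ Ideal.span {l}) := by
  set s : Set (Ideal R) := (A.minimalPrimes ∪ B.minimalPrimes) \ {IsLocalRing.maximalIdeal R}
  have hs : s.Finite :=
    ((A.finite_minimalPrimes_of_isNoetherianRing R).union
      (B.finite_minimalPrimes_of_isNoetherianRing R)).subset Set.sdiff_subset
  have hpr : ∀ P ∈ s, P.IsPrime := by
    rintro P ⟨h1 | h1, _⟩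
    · exact h1.1.1
    · exact h1.1.1
  have hno : ¬ ((IsLocalRing.maximalIdeal R : Set R) ⊆ ⋃ i ∈ s, (i : Ideal R)) := by
    rw [Ideal.subset_union_prime_finite (f := fun i : Ideal R => i) hs 0 0
      (fun i hi _ _ => hpr i hi)]
    rintro ⟨P, hP, hle⟩
    apply hP.2
    exact le_antisymm (IsLocalRing.le_maximalIdeal (hpr P hP).ne_top) hle
  rw [Set.not_subset] at hno
  obtain ⟨l, hl, hl2⟩ := hno
  simp only [Set.mem_iUnion, not_exists] at hl2
  refine ⟨l, hl, prim_of_avoid A h l hh hp ?_, prim_of_avoid B x l hx hq ?_⟩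
  · intro P hP hne
    exact hl2 P ⟨Or.inl hP, hne⟩
  · intro P hP hne
    exact hl2 P ⟨Or.inr hP, hne⟩

lemma sop_regular_aux {R : Type*} [CommRing R] [IsLocalRing R] [IsNoetherianRing R] (k : ℕ) :
    ∀ (hs xs ls : List R), hs.length = k → xs.length = k →
      (∀ r ∈ hs ++ ls, r ∈ IsLocalRing.maximalIdeal R) →
      (∀ r ∈ xs ++ ls, r ∈ IsLocalRing.maximalIdeal R) →
      Prim (Ideal.ofList (hs ++ ls)) → Prim (Ideal.ofList (xs ++ ls)) →
      IsWeaklyRegular R (xs ++ ls) → IsWeaklyRegular R (hs ++ ls) := by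
  induction k with
  | zero =>
    intro hs xs ls e1 e2 _ _ _ _ h
    rw [List.length_eq_zero_iff] at e1 e2
    subst e1 e2
    exact h
  | succ k ih =>
    intro hs xs ls e1 e2 m1 m2 p1 p2 hreg
    match hs, xs, e1, e2 with
    | h :: hs, x :: xs, e1, e2 =>
    simp only [List.length_cons, Nat.add_right_cancel_iff] at e1 e2
    have hh := m1 h (by simp)
    have hx := m2 x (by simp)
    have eA : ∀ (a : R) (as : List R), Ideal.ofList (as ++ [a]) =
        Ideal.ofList as ⊔ Ideal.span {a} := by
      intro a as; simp [Ideal.ofList_append]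
    have eB : ∀ (a : R) (as : List R), Ideal.ofList (a :: as) =
        Ideal.ofList as ⊔ Ideal.span {a} := by
      intro a as; rw [Ideal.ofList_cons, sup_comm]
    obtain ⟨l, hl, q1, q2⟩ := exists_two (Ideal.ofList (hs ++ ls)) (Ideal.ofList (xs ++ ls)) h x
      hh hx (by rw [← eB]; exact p1) (by rw [← eB]; exact p2)
    have r1 : IsWeaklyRegular R ((xs ++ ls) ++ [x]) :=
      IsLocalRing.isWeaklyRegular_of_perm_of_subset_maximalIdeal hreg
        (List.perm_append_singleton x (xs ++ ls)).symm m2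
    have r2 := exchange _ x l r1 hx (by rw [eA]; exact q2)
    have m2' : ∀ r ∈ xs ++ ls, r ∈ IsLocalRing.maximalIdeal R :=
      fun r hr => m2 r (List.mem_cons_of_mem _ hr)
    have m1' : ∀ r ∈ hs ++ ls, r ∈ IsLocalRing.maximalIdeal R :=
      fun r hr => m1 r (List.mem_cons_of_mem _ hr)
    have perm : ∀ as : List R, List.Perm ((as ++ ls) ++ [l]) (as ++ l :: ls) := by
      intro as
      exact (List.perm_append_singleton l (as ++ ls)).trans List.perm_middle.symm
    have aux : ∀ as : List R, Ideal.ofList (as ++ l :: ls) =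
        Ideal.ofList (as ++ ls) ⊔ Ideal.span {l} := by
      intro as
      simp only [Ideal.ofList_append, eB, sup_assoc]
    have mm : ∀ as : List R, (∀ r ∈ as ++ ls, r ∈ IsLocalRing.maximalIdeal R) →
        ∀ r ∈ as ++ l :: ls, r ∈ IsLocalRing.maximalIdeal R := by
      intro as h r hr
      simp only [List.mem_append, List.mem_cons] at hr h
      rcases hr with hr | rfl | hr
      · exact h r (Or.inl hr)
      · exact hl
      · exact h r (Or.inr hr)
    have mm' : ∀ as : List R, (∀ r ∈ as ++ ls, r ∈ IsLocalRing.maximalIdeal R) →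
        ∀ r ∈ (as ++ ls) ++ [l], r ∈ IsLocalRing.maximalIdeal R := by
      intro as h r hr
      exact mm as h r ((perm as).mem_iff.1 hr)
    have r3 := IsLocalRing.isWeaklyRegular_of_perm_of_subset_maximalIdeal r2 (perm xs) (mm' xs m2')
    have r4 := ih hs xs (l :: ls) e1 e2 (mm hs m1') (mm xs m2') (by rw [aux]; exact q1)
      (by rw [aux]; exact q2) r3
    have r5 := IsLocalRing.isWeaklyRegular_of_perm_of_subset_maximalIdeal r4 (perm hs).symm
      (mm hs m1')
    have r6 := exchange _ l h r5 hl (by rw [eA, ← eB]; exact p1)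
    refine IsLocalRing.isWeaklyRegular_of_perm_of_subset_maximalIdeal r6
        (List.perm_append_singleton h (hs ++ ls)) ?_
    intro r hr
    exact m1 r ((List.perm_append_singleton h (hs ++ ls)).mem_iff.1 hr)

lemma sop_regular {R : Type*} [CommRing R] [IsLocalRing R] [IsNoetherianRing R]
    (hs xs : List R) (e : hs.length = xs.length)
    (m1 : ∀ r ∈ hs, r ∈ IsLocalRing.maximalIdeal R)
    (m2 : ∀ r ∈ xs, r ∈ IsLocalRing.maximalIdeal R)
    (p1 : Prim (Ideal.ofList hs)) (p2 : Prim (Ideal.ofList xs))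
    (h : IsWeaklyRegular R xs) : IsWeaklyRegular R hs := by
  have := sop_regular_aux xs.length hs xs [] e rfl (by simpa using m1) (by simpa using m2)
    (by simpa using p1) (by simpa using p2) (by simpa using h)
  simpa using this

end partA

section partB

lemma exists_series_one {α : Type*} [Preorder α] {a b : α} (h : a < b) :
    ∃ s : LTSeries α, s.head = a ∧ s.length = 1 := by
  have hs : ∀ i : Fin 1, (![a, b] : Fin 2 → α) i.castSucc < (![a, b] : Fin 2 → α) i.succ := by
    intro i
    fin_cases i
    exact h
  exact ⟨⟨1, ![a, b], hs⟩, rfl, rfl⟩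

lemma exists_sop {k R : Type*} [Field k] [Infinite k] [CommRing R] [IsLocalRing R]
    [IsNoetherianRing R] [Algebra k R] (W : Submodule k R) (d : ℕ) : ∀ I : Ideal R,
    (∀ Q : Ideal R, Q.IsPrime → I ≤ Q → (∀ w ∈ W, w ∈ Q) → IsLocalRing.maximalIdeal R ≤ Q) →
    (∀ s : LTSeries (PrimeSpectrum R), I ≤ s.head.asIdeal → s.length ≤ d) →
    ∃ xs : List R, xs.length = d ∧ (∀ x ∈ xs, x ∈ W) ∧ Prim (I ⊔ Ideal.ofList xs) := by
  induction d with
  | zero =>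
    intro I hW hs
    refine ⟨[], rfl, by simp, ?_⟩
    intro Q hQ hle
    by_contra hcon
    have hlt : (⟨Q, hQ⟩ : PrimeSpectrum R) <
        ⟨IsLocalRing.maximalIdeal R, inferInstance⟩ :=
      lt_of_le_of_ne (IsLocalRing.le_maximalIdeal hQ.ne_top) (by
        intro e
        apply hcon
        have := congrArg PrimeSpectrum.asIdeal e
        simp only at this
        rw [this])
    obtain ⟨s, e1, e2⟩ := exists_series_one hlt
    have := hs s (by rw [e1]; simpa using hle)
    omega
  | succ d ih =>
    intro I hW hs
    set T : Set (Ideal R) := I.minimalPrimes \ {IsLocalRing.maximalIdeal R}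
    have hT : T.Finite :=
      (I.finite_minimalPrimes_of_isNoetherianRing R).subset Set.sdiff_subset
    have : Finite T := hT
    obtain ⟨w, hw⟩ : ∃ w : W, ∀ P ∈ T, (w : R) ∉ P := by
      by_contra hcon
      push Not at hcon
      let p : T → Subspace k W := fun P => (P.1.restrictScalars k).comap W.subtype
      have hcov : (⋃ i, (p i : Set W)) = Set.univ := by
        rw [Set.eq_univ_iff_forall]
        intro w
        obtain ⟨P, hP, hwP⟩ := hcon w
        exact Set.mem_iUnion.2 ⟨⟨P, hP⟩, hwP⟩
      obtain ⟨⟨P, hP⟩, htop⟩ := Subspace.exists_eq_top_of_iUnion_eq_univ hcov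
      have hPp : P.IsPrime := hP.1.1.1
      apply hP.2
      refine le_antisymm (IsLocalRing.le_maximalIdeal hPp.ne_top) (hW P hPp hP.1.1.2 ?_)
      intro w hw
      have : (⟨w, hw⟩ : W) ∈ p ⟨P, hP⟩ := by rw [htop]; trivial
      exact this
    obtain ⟨xs, h1, h2, h3⟩ := ih (I ⊔ Ideal.span {(w : R)})
      (fun Q hQ hle => hW Q hQ (le_sup_left.trans hle)) (by
        intro s hle
        obtain ⟨P, hP, hPQ⟩ := Ideal.exists_minimalPrimes_le (le_sup_left.trans hle)
        by_cases hPm : P = IsLocalRing.maximalIdeal R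
        · by_contra hlen
          have hpos : 0 < s.length := by omega
          have hlt : s.head < s.last := by
            apply s.strictMono
            rw [Fin.lt_def]
            simpa using hpos
          have h5 := IsLocalRing.le_maximalIdeal s.last.2.ne_top
          rw [hPm] at hPQ
          exact absurd hlt (not_lt_of_ge (h5.trans hPQ))
        · have hwP := hw P ⟨hP, hPm⟩
          have hlt : (⟨P, hP.1.1⟩ : PrimeSpectrum R) < s.head := by
            refine lt_of_le_of_ne hPQ ?_
            intro e
            apply hwP
            have e2 := congrArg PrimeSpectrum.asIdeal e
            simp only at e2
            rw [e2]
            exact hle (Ideal.mem_sup_right (Ideal.mem_span_singleton_self _))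
          have := hs (s.cons _ hlt) (by simpa using hP.1.2)
          simpa using this)
    refine ⟨w :: xs, by simp [h1], ?_, ?_⟩
    · intro x hx
      rcases List.mem_cons.1 hx with rfl | hx
      · exact w.2
      · exact h2 x hx
    · rwa [Ideal.ofList_cons, ← sup_assoc]

end partB

section partC
open MvPolynomial

/-- linear form centred at u -/
noncomputable def linU {n : ℕ} (u : Fin n → ℂ) : (Fin n → ℂ) →ₗ[ℂ] MvPolynomial (Fin n) ℂ where
  toFun v := ∑ j, C (v j) * (X j - C (u j))
  map_add' := by intros; simp [add_mul, Finset.sum_add_distrib]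
  map_smul' := by intros; simp [Finset.smul_sum, smul_eq_C_mul, mul_assoc]

lemma mem_vI {n : ℕ} (u : Fin n → ℂ) (p : MvPolynomial (Fin n) ℂ) :
    p ∈ vanishingIdeal ℂ {u} ↔ eval u p = 0 := by
  rw [mem_vanishingIdeal_singleton_iff, aeval_eq_eval]

lemma taylor_one {n : ℕ} (u : Fin n → ℂ) (p : MvPolynomial (Fin n) ℂ) :
    p - C (eval u p) - linU u (fun j => eval u (pderiv j p)) ∈ (vanishingIdeal ℂ {u}) ^ 2 := by
  have hlin : ∀ v, linU u v ∈ vanishingIdeal ℂ {u} := by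
    intro v
    rw [mem_vI]
    simp [linU]
  induction p using MvPolynomial.induction_on with
  | C a =>
    have : linU u (fun j => eval u (pderiv j (C a : MvPolynomial (Fin n) ℂ))) = 0 := by
      simp [linU]
    rw [this]; simp
  | add p q hp hq =>
    have : linU u (fun j => eval u (pderiv j (p + q))) =
      linU u (fun j => eval u (pderiv j p)) + linU u (fun j => eval u (pderiv j q)) := by
      rw [← map_add]; congr 1; ext j; simp
    rw [this]
    convert Ideal.add_mem _ hp hq using 1
    rw [map_add, map_add]; ring
  | mul_X p i hp =>
    have : linU u (fun j => eval u (pderiv j (p * X i))) =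
      C (u i) * linU u (fun j => eval u (pderiv j p)) + C (eval u p) * (X i - C (u i)) := by
      simp only [linU, LinearMap.coe_mk, AddHom.coe_mk, Finset.mul_sum]
      have h2 : C (eval u p) * (X i - C (u i)) =
        ∑ j, C (eval u p * if j = i then 1 else 0) * (X j - C (u j) : MvPolynomial (Fin n) ℂ) := by
        rw [Finset.sum_eq_single i] <;> simp +contextual
      rw [h2, ← Finset.sum_add_distrib]
      refine Finset.sum_congr rfl fun j _ => ?_
      rw [pderiv_mul, pderiv_X]
      simp only [map_add, map_mul, eval_X, Pi.single_apply]
      by_cases hji : j = i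
      · subst hji
        simp; ring
      · have hij : ¬ i = j := fun h => hji h.symm
        simp [hji, hij]; ring
    rw [this]
    have h3 : p * X i - C (eval u (p * X i)) - (C (u i) * linU u (fun j => eval u (pderiv j p)) +
        C (eval u p) * (X i - C (u i))) =
        X i * (p - C (eval u p) - linU u (fun j => eval u (pderiv j p))) +
        linU u (fun j => eval u (pderiv j p)) * (X i - C (u i)) := by
      rw [map_mul, eval_X, C_mul]; ring
    rw [h3]
    refine Ideal.add_mem _ (Ideal.mul_mem_left _ _ hp) ?_
    rw [pow_two]
    refine Ideal.mul_mem_mul (hlin _) ?_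
    rw [mem_vI]; simp

lemma chain_point {n c : ℕ} (f : Fin c → MvPolynomial (Fin n) ℂ) (u : Fin n → ℂ)
    (hu : ∀ i, eval u (f i) = 0)
    (hli : LinearIndependent ℂ (fun i : Fin c => fun j : Fin n => eval u (pderiv j (f i))))
    (s : LTSeries (PrimeSpectrum (MvPolynomial (Fin n) ℂ)))
    (hs : Ideal.span (Set.range f) ≤ s.head.asIdeal)
    (hl : s.last.asIdeal = vanishingIdeal ℂ {u}) : s.length ≤ n - c := by
  let S := MvPolynomial (Fin n) ℂ
  set I := Ideal.span (Set.range f)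
  set mu : Ideal S := vanishingIdeal ℂ {u}
  obtain ⟨W, hW⟩ := Submodule.exists_isCompl
    (Submodule.span ℂ (Set.range (fun i : Fin c => fun j : Fin n => eval u (pderiv j (f i)))))
  have hWr : Module.finrank ℂ W = n - c := by
    have h1 := Submodule.finrank_add_eq_of_isCompl hW
    rw [finrank_span_eq_card hli] at h1
    simp at h1
    omega
  let b := Module.finBasis ℂ W
  let l : Fin (Module.finrank ℂ W) → S := fun i => linU u (b i : Fin n → ℂ)
  -- key
  have key : ∀ Q : Ideal S, Q.IsPrime → I ≤ Q → (∀ i, l i ∈ Q) → Q ≤ mu → mu ≤ Q := by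
    intro Q hQ hIQ hlQ hQm
    have hall : ∀ v, linU u v ∈ Q ⊔ mu ^ 2 := by
      let T : Submodule ℂ (Fin n → ℂ) := ((Q ⊔ mu ^ 2).restrictScalars ℂ).comap (linU u)
      have hT : T = ⊤ := by
        rw [eq_top_iff, ← hW.sup_eq_top, sup_le_iff]
        constructor
        · rw [Submodule.span_le]
          rintro _ ⟨i, rfl⟩
          change linU u _ ∈ Q ⊔ mu ^ 2
          have := taylor_one u (f i)
          rw [hu i, map_zero, sub_zero] at this
          have h2 := Ideal.sub_mem _ (Ideal.mem_sup_left (T := mu ^ 2)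
            (hIQ (Ideal.subset_span ⟨i, rfl⟩))) (Ideal.mem_sup_right (S := Q) this)
          simpa using h2
        · have : W = Submodule.map W.subtype (Submodule.span ℂ (Set.range b)) := by
            rw [b.span_eq]; simp
          rw [this, Submodule.map_span, Submodule.span_le]
          rintro _ ⟨_, ⟨i, rfl⟩, rfl⟩
          exact Ideal.mem_sup_left (hlQ i)
      intro v
      have : v ∈ T := by rw [hT]; trivial
      exact this
    have hle : mu ≤ Q ⊔ mu ^ 2 := by
      intro p hp
      have h1 := taylor_one u p
      rw [(mem_vI u p).1 hp, map_zero, sub_zero] at h1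
      have := Ideal.add_mem _ (Ideal.mem_sup_right (S := Q) h1) (hall (fun j => eval u (pderiv j p)))
      simpa using this
    have hid : IsIdempotentElem (mu.map (Ideal.Quotient.mk Q)) := by
      refine le_antisymm Ideal.mul_le_left ?_
      have h2 := Ideal.map_mono (f := Ideal.Quotient.mk Q) hle
      rw [Ideal.map_sup, Ideal.map_quotient_self, bot_sup_eq, pow_two, Ideal.map_mul] at h2
      exact h2
    rw [Ideal.isIdempotentElem_iff_eq_bot_or_top _ (IsNoetherian.noetherian _)] at hid
    rcases hid with h | h
    · rw [Ideal.map_eq_bot_iff_le_ker, Ideal.mk_ker] at h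
      exact h
    · exfalso
      have h2 := congrArg (Ideal.comap (Ideal.Quotient.mk Q)) h
      rw [Ideal.comap_map_of_surjective _ Ideal.Quotient.mk_surjective, Ideal.comap_top,
        ← RingHom.ker_eq_comap_bot, Ideal.mk_ker, sup_eq_left.2 hQm] at h2
      exact (inferInstance : (vanishingIdeal ℂ {u} : Ideal S).IsPrime).ne_top h2
  -- series in quotient
  have hIs : ∀ i, RingHom.ker (Ideal.Quotient.mk I) ≤ (s i).asIdeal := by
    intro i
    rw [Ideal.mk_ker]
    exact hs.trans (s.monotone (Fin.zero_le i))
  have hpr : ∀ i, ((s i).asIdeal.map (Ideal.Quotient.mk I)).IsPrime := fun i =>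
    Ideal.map_isPrime_of_surjective Ideal.Quotient.mk_surjective (hIs i)
  have hcm : ∀ i, ((s i).asIdeal.map (Ideal.Quotient.mk I)).comap (Ideal.Quotient.mk I) =
      (s i).asIdeal := by
    intro i
    rw [Ideal.comap_map_of_surjective _ Ideal.Quotient.mk_surjective, ← RingHom.ker_eq_comap_bot,
      sup_eq_left.2 (hIs i)]
  let t : LTSeries (PrimeSpectrum (S ⧸ I)) := LTSeries.mk s.length
    (fun i => ⟨(s i).asIdeal.map (Ideal.Quotient.mk I), hpr i⟩) (by
      intro i j hij
      have := s.strictMono hij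
      refine lt_of_le_of_ne (Ideal.map_mono this.le) ?_
      intro e
      apply this.ne
      apply PrimeSpectrum.ext
      rw [← hcm i, ← hcm j]
      exact congrArg (fun x => Ideal.comap (Ideal.Quotient.mk I) (PrimeSpectrum.asIdeal x)) e)
  have h1 := Order.length_le_height_last (p := t)
  rw [← PrimeSpectrum.height_eq_orderHeight] at h1
  have hlast : t.last.asIdeal = mu.map (Ideal.Quotient.mk I) := by
    rw [← hl]; rfl
  have hmin : t.last.asIdeal ∈ (Ideal.span
      (Set.range (fun i => Ideal.Quotient.mk I (l i)))).minimalPrimes := by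
    have hcmu : (mu.map (Ideal.Quotient.mk I)).comap (Ideal.Quotient.mk I) = mu := by
      rw [← hl]; exact hcm (Fin.last _)
    refine ⟨⟨t.last.2, ?_⟩, ?_⟩
    · rw [Ideal.span_le, hlast]
      rintro _ ⟨i, rfl⟩
      refine Ideal.mem_map_of_mem _ ?_
      rw [mem_vI]
      simp [l, linU]
    · rintro Q ⟨hQ, hle⟩ hQt
      rw [hlast] at hQt ⊢
      rw [Ideal.map_le_iff_le_comap]
      refine key _ (Ideal.comap_isPrime _ _) ?_ ?_ ?_
      · rw [← Ideal.map_le_iff_le_comap, Ideal.map_quotient_self]; exact bot_le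
      · intro i
        exact hle (Ideal.subset_span ⟨i, rfl⟩)
      · rw [← hcmu]; exact Ideal.comap_mono hQt
  have h2 := Ideal.height_le_card_of_mem_minimalPrimes_span (Set.finite_range _) hmin
  have h3 : (Set.range (fun i => Ideal.Quotient.mk I (l i))).ncard ≤ n - c := by
    rw [← Set.image_univ]
    refine (Set.ncard_image_le).trans ?_
    rw [Set.ncard_univ, Nat.card_eq_fintype_card, Fintype.card_fin, hWr]
  have h4 := h1.trans h2
  have h5 : s.length ≤ (Set.range (fun i => Ideal.Quotient.mk I (l i))).ncard := by exact_mod_cast h4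
  exact h5.trans h3

/-- the ideal of the origin -/
noncomputable abbrev mO (n : ℕ) : Ideal (MvPolynomial (Fin n) ℂ) := vanishingIdeal ℂ {(0 : Fin n → ℂ)}

/-- local ring at the origin -/
abbrev LO (n : ℕ) : Type := Localization.AtPrime (mO n)

lemma exists_point {n : ℕ} (P : Ideal (MvPolynomial (Fin n) ℂ)) (hP : P.IsPrime)
    (hlt : ¬ mO n ≤ P) : ∃ u : Fin n → ℂ, u ≠ 0 ∧ ∀ p ∈ P, eval u p = 0 := by
  by_contra hcon
  push Not at hcon
  apply hlt
  rw [← IsPrime.vanishingIdeal_zeroLocus (K := ℂ) P]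
  apply vanishingIdeal_anti_mono
  intro u hu
  by_contra hne
  obtain ⟨p, hp, hpu⟩ := hcon u hne
  apply hpu
  have := hu p hp
  rwa [aeval_eq_eval] at this

lemma chain_bound {n c : ℕ} (f : Fin c → MvPolynomial (Fin n) ℂ)
    (hli : ∀ u : Fin n → ℂ, u ≠ 0 → (∀ i, eval u (f i) = 0) →
      LinearIndependent ℂ (fun i : Fin c => fun j : Fin n => eval u (pderiv j (f i))))
    (s : LTSeries (PrimeSpectrum (LO n)))
    (hs : (Ideal.span (Set.range f)).map (algebraMap _ (LO n)) ≤ s.head.asIdeal) :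
    s.length ≤ n - c := by
  by_cases h0 : s.length = 0
  · omega
  have hmono : StrictMono (PrimeSpectrum.comap (algebraMap (MvPolynomial (Fin n) ℂ) (LO n))) := by
    intro a b hab
    refine lt_of_le_of_ne (Ideal.comap_mono hab.le) ?_
    intro e
    exact hab.ne (PrimeSpectrum.localization_comap_injective (LO n) (mO n).primeCompl e)
  let t := s.map _ hmono
  have ht : t.length = s.length := rfl
  have hlt : t.eraseLast.last < t.last := t.eraseLast_last_rel_last (by rw [ht]; exact h0)
  have hle : t.last.asIdeal ≤ mO n := by
    have := IsLocalRing.le_maximalIdeal s.last.2.ne_top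
    have h2 := Ideal.comap_mono (f := algebraMap (MvPolynomial (Fin n) ℂ) (LO n)) this
    exact h2.trans (le_of_eq (Localization.AtPrime.under_maximalIdeal (I := mO n)))
  obtain ⟨u, hu0, hu⟩ := exists_point t.eraseLast.last.asIdeal t.eraseLast.last.2 (by
    intro h
    exact absurd hlt (not_lt_of_ge (hle.trans h)))
  have hI : Ideal.span (Set.range f) ≤ t.head.asIdeal := by
    rw [Ideal.map_le_iff_le_comap] at hs
    exact hs
  have huI : ∀ i, eval u (f i) = 0 := by
    intro i
    apply hu
    have h3 : t.eraseLast.head ≤ t.eraseLast.last := LTSeries.monotone t.eraseLast (Fin.zero_le _)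
    rw [RelSeries.head_eraseLast] at h3
    exact h3 (hI (Ideal.subset_span ⟨i, rfl⟩))
  have hPu : t.eraseLast.last < (⟨vanishingIdeal ℂ {u}, inferInstance⟩ : PrimeSpectrum _) := by
    refine lt_of_le_of_ne (fun p hp => (mem_vI u p).2 (hu p hp)) ?_
    intro e
    have hmax : (vanishingIdeal ℂ {u} : Ideal (MvPolynomial (Fin n) ℂ)).IsMaximal := inferInstance
    have e2 := congrArg PrimeSpectrum.asIdeal e
    simp only at e2
    have h4 : t.eraseLast.last.asIdeal < t.last.asIdeal := hlt
    rw [e2] at h4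
    exact t.last.2.ne_top (hmax.out.2 _ h4)
  have := chain_point f u huI (hli u hu0 huI) (t.eraseLast.snoc _ hPu) (by simpa using hI) (by simp)
  simp only [RelSeries.snoc_length, RelSeries.eraseLast_length] at this
  omega

end partC

section partD
open MvPolynomial TensorProduct

lemma isReduced_of_smooth (k A : Type*) [Field k] [CommRing A] [Algebra k A] [Algebra.Smooth k A] :
    IsReduced A := by
  refine ⟨fun a ha => ?_⟩
  have hb := TensorProduct.toIntegralClosure_bijective_of_smooth (R := k) (S := A)
    (B := Polynomial k)
  have hint : IsIntegral A (a ⊗ₜ[k] (Polynomial.X : Polynomial k)) := by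
    obtain ⟨r, hr⟩ := ha
    refine IsIntegral.of_pow (n := r + 1) (by omega) ?_
    rw [Algebra.TensorProduct.tmul_pow, pow_succ, hr]
    simpa using isIntegral_zero
  obtain ⟨t, ht⟩ := hb.2 ⟨_, hint⟩
  have ht' := congrArg Subtype.val ht
  have hz : ∀ b : integralClosure k (Polynomial k), (Polynomial.lcoeff k 1) b.1 = 0 := by
    intro b
    by_contra hne
    have h1 : b.1.natDegree ≠ 0 := by
      intro h0
      apply hne
      rw [Polynomial.lcoeff_apply]
      exact Polynomial.coeff_eq_zero_of_natDegree_lt (by rw [h0]; exact one_pos)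
    have h2 : IsAlgebraic k b.1 := isAlgebraic_iff_isIntegral.2 b.2
    exact Polynomial.transcendental b.1 h1 (by
      have := (Polynomial.leadingCoeff_ne_zero (p := b.1)).2 (by rintro h; simp [h] at h1)
      exact IsUnit.mem_nonZeroDivisors this.isUnit) h2
  have key : ∀ t : A ⊗[k] integralClosure k (Polynomial k),
      (TensorProduct.map LinearMap.id (Polynomial.lcoeff k 1) : A ⊗[k] Polynomial k →ₗ[k] A ⊗[k] k)
        (TensorProduct.toIntegralClosure k A (Polynomial k) t).1 = 0 := by
    intro t
    induction t with
    | zero => simp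
    | add x y hx hy => rw [map_add]; simp only [Subalgebra.coe_add]; rw [map_add, hx, hy, add_zero]
    | tmul x y =>
      have : (TensorProduct.toIntegralClosure k A (Polynomial k) (x ⊗ₜ y)).1 = x ⊗ₜ y.1 := by
        simp [TensorProduct.toIntegralClosure]
      rw [this, TensorProduct.map_tmul, hz, TensorProduct.tmul_zero]
  have h3 := key t
  rw [ht'] at h3
  simp only [TensorProduct.map_tmul, LinearMap.id_coe, id_eq, Polynomial.lcoeff_apply,
    Polynomial.coeff_X_one] at h3
  have := congrArg (TensorProduct.rid k A) h3
  simpa using this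

/-- relations of the localized complete intersection -/
noncomputable def relD {k : Type} [Field k] {c n : ℕ} (f : Fin c → MvPolynomial (Fin n) k)
    (J : MvPolynomial (Fin n) k) : Option (Fin c) → MvPolynomial (Option (Fin n)) k
  | some i => rename some (f i)
  | none => rename some J * X none - 1

/-- Jacobian minor -/
noncomputable def minorJ {k : Type} [Field k] {c n : ℕ} (f : Fin c → MvPolynomial (Fin n) k)
    (s : Fin c → Fin n) : MvPolynomial (Fin n) k :=
  (Matrix.of fun i j => pderiv (s i) (f j)).det

lemma pderiv_none_rename {k : Type} [Field k] {n : ℕ} (p : MvPolynomial (Fin n) k) :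
    pderiv none (rename some p) = 0 := by
  apply pderiv_eq_zero_of_notMem_vars
  intro h
  have := vars_rename (some : Fin n → Option (Fin n)) p h
  simp at this

lemma smooth_relD {k : Type} [Field k] {c n : ℕ} (f : Fin c → MvPolynomial (Fin n) k)
    (s : Fin c → Fin n) (hs : Function.Injective s) :
    Algebra.Smooth k (MvPolynomial (Option (Fin n)) k ⧸
      Ideal.span (Set.range (relD f (minorJ f s)))) := by
  let P := Algebra.PreSubmersivePresentation.naive (v := relD f (minorJ f s)) (Option.map s)
    (Option.map_injective hs)
  have hP : IsUnit P.jacobian := by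
    rw [P.jacobian_eq_jacobiMatrix_det]
    have hdet : P.jacobiMatrix.det = rename some (minorJ f s) * rename some (minorJ f s) := by
      have hJ : ∀ i j, P.jacobiMatrix i j = pderiv (Option.map s i) (relD f (minorJ f s) j) :=
        fun i j => Algebra.PreSubmersivePresentation.jacobiMatrix_naive _ _ _ _ i j
      rw [← Matrix.det_reindex_self (Equiv.optionEquivSumPUnit.{0} (Fin c))]
      have hblk : Matrix.reindex (Equiv.optionEquivSumPUnit.{0} (Fin c))
          (Equiv.optionEquivSumPUnit.{0} (Fin c)) P.jacobiMatrix =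
          Matrix.fromBlocks ((rename some : _ →ₐ[k] MvPolynomial (Option (Fin n)) k).mapMatrix
            (Matrix.of fun i j => pderiv (s i) (f j)))
            (Matrix.of fun i _ => pderiv (some (s i)) (relD f (minorJ f s) none)) 0
            (Matrix.of fun _ _ => rename some (minorJ f s)) := by
        ext1 i j
        rw [Matrix.reindex_apply, Matrix.submatrix_apply, hJ]
        rcases i with i | i <;> rcases j with j | j
        · change pderiv (some (s i)) (rename some (f j)) = rename some (pderiv (s i) (f j))
          exact pderiv_rename (Option.some_injective _) _ _
        · rfl
        · exact pderiv_none_rename _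
        · change pderiv none (rename some (minorJ f s) * X none - 1) = _
          simp [pderiv_none_rename]
      rw [hblk, Matrix.det_fromBlocks_zero₂₁, ← AlgHom.map_det]
      simp [minorJ]
    rw [hdet, map_mul]
    have : IsUnit (algebraMap P.Ring (MvPolynomial (Option (Fin n)) k ⧸
      Ideal.span (Set.range (relD f (minorJ f s)))) (rename some (minorJ f s))) := by
      refine IsUnit.of_mul_eq_one (Ideal.Quotient.mk _ (X none)) ?_
      change Ideal.Quotient.mk _ (rename some (minorJ f s)) * Ideal.Quotient.mk _ (X none) = 1
      rw [← map_mul, ← sub_eq_zero, ← map_one (Ideal.Quotient.mk _), ← map_sub,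
        Ideal.Quotient.eq_zero_iff_mem]
      exact Ideal.subset_span ⟨none, rfl⟩
    exact this.mul this
  let Q : Algebra.SubmersivePresentation k (MvPolynomial (Option (Fin n)) k ⧸
      Ideal.span (Set.range (relD f (minorJ f s)))) (Option (Fin n)) (Option (Fin c)) :=
    { P with jacobian_isUnit := hP }
  have := Q.isStandardSmooth
  infer_instance

lemma jac_pow_mem {k : Type} [Field k] {c n : ℕ} (f : Fin c → MvPolynomial (Fin n) k)
    (s : Fin c → Fin n) (p : MvPolynomial (Fin n) k)
    (hp : p ∈ (Ideal.span (Set.range f)).radical) :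
    ∃ M, minorJ f s ^ M * p ∈ Ideal.span (Set.range f) := by
  by_cases hs : Function.Injective s
  swap
  · refine ⟨1, ?_⟩
    have : minorJ f s = 0 := by
      simp only [Function.Injective] at hs
      push Not at hs
      obtain ⟨a, b, hab, hne⟩ := hs
      exact Matrix.det_zero_of_row_eq hne (by ext j; simp [hab])
    simp [this]
  have := smooth_relD f s hs
  have := isReduced_of_smooth k (MvPolynomial (Option (Fin n)) k ⧸
      Ideal.span (Set.range (relD f (minorJ f s))))
  obtain ⟨r, hr⟩ := hp
  have h1 : rename some p ∈ Ideal.span (Set.range (relD f (minorJ f s))) := by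
    rw [← Ideal.Quotient.eq_zero_iff_mem]
    apply eq_zero_of_pow_eq_zero (n := r)
    rw [← map_pow, Ideal.Quotient.eq_zero_iff_mem, ← map_pow]
    have h2 := Ideal.mem_map_of_mem (rename some : _ →ₐ[k] MvPolynomial (Option (Fin n)) k) hr
    rw [Ideal.map_span] at h2
    refine Ideal.span_mono ?_ h2
    rintro _ ⟨_, ⟨i, rfl⟩, rfl⟩
    exact ⟨some i, rfl⟩
  set I := Ideal.span (Set.range f)
  let J := Ideal.Quotient.mk I (minorJ f s)
  let L := Localization.Away J
  let Φ : MvPolynomial (Option (Fin n)) k →ₐ[k] L :=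
    aeval (fun o => o.elim (IsLocalization.Away.invSelf J)
      (fun i => algebraMap _ L (Ideal.Quotient.mk I (X i))))
  have hΦ : ∀ q : MvPolynomial (Fin n) k, Φ (rename some q) =
      algebraMap _ L (Ideal.Quotient.mk I q) := by
    intro q
    have : Φ.comp (rename some) =
        (IsScalarTower.toAlgHom k (MvPolynomial (Fin n) k ⧸ I) L).comp (Ideal.Quotient.mkₐ k I) := by
      ext i
      simp [Φ]
    exact congrArg (fun g => g q) this
  have h3 : Φ (rename some p) = 0 := by
    have hle : Ideal.span (Set.range (relD f (minorJ f s))) ≤ RingHom.ker Φ := by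
      rw [Ideal.span_le]
      rintro _ ⟨i, rfl⟩
      rw [SetLike.mem_coe, RingHom.mem_ker]
      cases i with
      | some i =>
        simp only [relD]
        have hfi : f i ∈ I := Ideal.subset_span ⟨i, rfl⟩
        rw [hΦ, Ideal.Quotient.eq_zero_iff_mem.2 hfi, map_zero]
      | none =>
        simp only [relD]
        rw [map_sub, map_mul, hΦ]
        have : Φ (X none) = IsLocalization.Away.invSelf J := by simp [Φ]
        rw [this, map_one, sub_eq_zero]
        exact IsLocalization.Away.mul_invSelf J
    exact hle h1
  rw [hΦ, IsLocalization.map_eq_zero_iff (Submonoid.powers J)] at h3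
  obtain ⟨⟨_, M, rfl⟩, hM⟩ := h3
  refine ⟨M, ?_⟩
  rw [← Ideal.Quotient.eq_zero_iff_mem, map_mul, map_pow]
  exact hM

end partD

section partE
open MvPolynomial RingTheory.Sequence

lemma vars_wr {n : ℕ} (l : List (Fin n)) (hl : l.Nodup) :
    IsWeaklyRegular (MvPolynomial (Fin n) ℂ) (l.map (X : Fin n → MvPolynomial (Fin n) ℂ)) := by
  induction l using List.reverseRecOn with
  | nil => simp
  | append_singleton l b ih =>
    rw [List.map_append, List.map_singleton, wr_snoc]
    rw [List.nodup_append] at hl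
    refine ⟨ih hl.1, ?_⟩
    intro z hz
    have hof : Ideal.ofList (l.map (X : Fin n → MvPolynomial (Fin n) ℂ)) =
        Ideal.span (X '' {i | i ∈ l}) := by
      rw [Ideal.ofList]
      congr 1
      ext p; simp
    rw [hof, mem_ideal_span_X_image] at hz ⊢
    intro m hm
    obtain ⟨i, hi, hne⟩ := hz (Finsupp.single b 1 + m) (by
      rw [support_X_mul]
      exact Finset.mem_map.2 ⟨m, hm, rfl⟩)
    refine ⟨i, hi, ?_⟩
    have : b ≠ i := by
      rintro rfl
      exact hl.2.2 b hi b (by simp) rfl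
    simpa [Finsupp.single_apply, this] using hne

lemma prim_vars {n : ℕ} : Prim (Ideal.ofList
    (((List.finRange n).map X).map (algebraMap (MvPolynomial (Fin n) ℂ) (LO n)))) := by
  intro Q hQ hle
  rw [← Localization.AtPrime.map_eq_maximalIdeal, Ideal.map_le_iff_le_comap]
  intro p hp
  rw [mem_vI] at hp
  have h1 : p ∈ Ideal.span ((X : Fin n → MvPolynomial (Fin n) ℂ) '' Set.univ) := by
    rw [mem_ideal_span_X_image]
    intro m hm
    by_contra hcon
    push Not at hcon
    have : m = 0 := by ext i; exact hcon i trivial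
    rw [this, mem_support_iff] at hm
    apply hm
    rw [← hp, ← constantCoeff_eq, eval_zero]
  have h2 : Ideal.span ((X : Fin n → MvPolynomial (Fin n) ℂ) '' Set.univ) ≤
      Q.comap (algebraMap (MvPolynomial (Fin n) ℂ) (LO n)) := by
    rw [Ideal.span_le]
    rintro _ ⟨i, _, rfl⟩
    apply hle
    apply Ideal.subset_span
    simp
  exact h2 h1

lemma exists_minor_ne {n c : ℕ} (M : Fin c → Fin n → ℂ) (h : LinearIndependent ℂ M) :
    ∃ s : Fin c → Fin n, (Matrix.of fun i j => M j (s i)).det ≠ 0 := by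
  have hr : (Matrix.of M).rank = c := by
    have := LinearIndependent.rank_matrix (M := Matrix.of M) h
    simpa using this
  rw [Matrix.rank_eq_finrank_span_cols] at hr
  obtain ⟨κ, a, ha, hsp, hli⟩ := exists_linearIndependent' ℂ (Matrix.of M).col
  rw [← hsp] at hr
  have : Finite κ := Finite.of_injective a ha
  have := Fintype.ofFinite κ
  rw [finrank_span_eq_card hli] at hr
  let e : Fin c ≃ κ := (Fintype.equivFinOfCardEq hr).symm
  refine ⟨a ∘ e, ?_⟩
  have h2 : LinearIndependent ℂ (Matrix.of fun i j => M j ((a ∘ e) i)).row :=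
    hli.comp e e.injective
  rw [Matrix.linearIndependent_rows_iff_isUnit, Matrix.isUnit_iff_isUnit_det] at h2
  exact h2.ne_zero

lemma eval_minorJ {n c : ℕ} (f : Fin c → MvPolynomial (Fin n) ℂ) (s : Fin c → Fin n)
    (u : Fin n → ℂ) :
    eval u (minorJ f s) = (Matrix.of fun i j => eval u (pderiv (s i) (f j))).det := by
  rw [minorJ, RingHom.map_det]
  congr 1

lemma exists_xy {n c : ℕ} (hc : 1 ≤ c) (hcn : c + 2 ≤ n) (f : Fin c → MvPolynomial (Fin n) ℂ)
    (hf0 : ∀ i, eval 0 (f i) = 0) (hdf0 : ∀ i j, eval 0 (pderiv j (f i)) = 0)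
    (hli : ∀ u : Fin n → ℂ, u ≠ 0 → (∀ i, eval u (f i) = 0) →
      LinearIndependent ℂ (fun i : Fin c => fun j : Fin n => eval u (pderiv j (f i)))) :
    ∃ x ∈ Submodule.span ℂ (Set.range (minorJ f)), ∃ y ∈ Submodule.span ℂ (Set.range (minorJ f)),
      (∀ z, algebraMap _ (LO n) x * z ∈ (Ideal.span (Set.range f)).map (algebraMap _ (LO n)) →
        z ∈ (Ideal.span (Set.range f)).map (algebraMap _ (LO n))) ∧
      (∀ z, algebraMap _ (LO n) y * z ∈
        (Ideal.span (Set.range f) ⊔ Ideal.span {x}).map (algebraMap _ (LO n)) →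
        z ∈ (Ideal.span (Set.range f) ⊔ Ideal.span {x}).map (algebraMap _ (LO n))) := by
  set W : Submodule ℂ (LO n) := (Submodule.span ℂ (Set.range (minorJ f))).map
    (IsScalarTower.toAlgHom ℂ (MvPolynomial (Fin n) ℂ) (LO n)).toLinearMap with hWdef
  set I := Ideal.span (Set.range f)
  have hmem : ∀ p, algebraMap (MvPolynomial (Fin n) ℂ) (LO n) p ∈ IsLocalRing.maximalIdeal (LO n) ↔
      eval 0 p = 0 := by
    intro p
    rw [← mem_vI]
    have : (IsLocalRing.maximalIdeal (LO n)).comap (algebraMap (MvPolynomial (Fin n) ℂ) (LO n)) =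
      mO n := Localization.AtPrime.under_maximalIdeal (I := mO n)
    exact SetLike.ext_iff.1 this p
  have hmin0 : ∀ w ∈ Submodule.span ℂ (Set.range (minorJ f)), eval 0 w = 0 := by
    intro w hw
    induction hw using Submodule.span_induction with
    | mem w hw =>
      obtain ⟨s, rfl⟩ := hw
      rw [eval_minorJ]
      have : (Matrix.of fun i j => eval 0 (pderiv (s i) (f j))) = 0 := by
        ext i j; exact hdf0 _ _
      rw [this]
      haveI : Nonempty (Fin c) := ⟨⟨0, hc⟩⟩
      exact Matrix.det_zero
    | zero => simp
    | add a b _ _ ha hb => rw [map_add, ha, hb, add_zero]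
    | smul r a _ ha => rw [smul_eq_C_mul, map_mul, ha, mul_zero]
  obtain ⟨xs, hlen, hxW, hprim⟩ := exists_sop W (n - c) (I.map (algebraMap _ (LO n))) (by
    intro Q hQ hIQ hWQ
    rw [← Localization.AtPrime.map_eq_maximalIdeal, Ideal.map_le_iff_le_comap]
    by_contra hcon
    obtain ⟨u, hu0, hu⟩ := exists_point (Q.comap (algebraMap (MvPolynomial (Fin n) ℂ) (LO n)))
      (Ideal.comap_isPrime _ _) hcon
    have h1 : ∀ i, eval u (f i) = 0 := fun i => hu _ (by
      rw [Ideal.map_le_iff_le_comap] at hIQ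
      exact hIQ (Ideal.subset_span ⟨i, rfl⟩))
    obtain ⟨s, hs⟩ := exists_minor_ne _ (hli u hu0 h1)
    apply hs
    rw [← eval_minorJ]
    refine hu _ (hWQ _ ⟨minorJ f s, Submodule.subset_span ⟨s, rfl⟩, rfl⟩)) 
    (chain_bound f hli)
  set fs : List (LO n) := (List.ofFn f).map (algebraMap _ (LO n))
  have hIfs : I.map (algebraMap _ (LO n)) = Ideal.ofList fs := by
    rw [← Ideal.map_ofList]
    congr 1
    change Ideal.span (Set.range f) = Ideal.span _
    congr 1
    ext p; simp [List.mem_ofFn, Set.mem_range]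
  have hreg : IsWeaklyRegular (LO n) (fs ++ xs) := by
    refine sop_regular (fs ++ xs) (((List.finRange n).map X).map (algebraMap _ (LO n))) ?_ ?_ ?_ ?_
      prim_vars ?_
    · simp [fs, hlen]; omega
    · intro r hr
      rcases List.mem_append.1 hr with hr | hr
      · simp only [fs, List.mem_map, List.mem_ofFn] at hr
        obtain ⟨_, ⟨i, rfl⟩, rfl⟩ := hr
        rw [hmem]; exact hf0 i
      · obtain ⟨w, hw, rfl⟩ := hxW r hr
        exact (hmem w).2 (hmin0 w hw)
    · intro r hr
      simp only [List.mem_map] at hr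
      obtain ⟨_, ⟨i, _, rfl⟩, rfl⟩ := hr
      rw [hmem]; simp
    · rw [Ideal.ofList_append, ← hIfs]; exact hprim
    · exact (vars_wr _ (List.nodup_finRange n)).of_isLocalization (LO n) (mO n).primeCompl
  match xs, hlen, hxW, hreg with
  | [], hlen, _, _ => simp at hlen; omega
  | [_], hlen, _, _ => simp at hlen; omega
  | x' :: y' :: rest, hlen, hxW, hreg =>
    obtain ⟨x, hx, rfl⟩ := hxW x' (by simp)
    obtain ⟨y, hy, rfl⟩ := hxW y' (by simp)
    refine ⟨x, hx, y, hy, ?_⟩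
    have e1 : ∀ a b : LO n, fs ++ a :: b :: rest = ((fs ++ [a]) ++ [b]) ++ rest := by
      intro a b; simp
    rw [e1, isWeaklyRegular_append_iff] at hreg
    have h2 := hreg.1
    rw [wr_snoc, wr_snoc] at h2
    refine ⟨?_, ?_⟩
    · rw [hIfs]; exact h2.1.2
    · have : (I ⊔ Ideal.span {x}).map (algebraMap _ (LO n)) =
          Ideal.ofList (fs ++ [algebraMap _ (LO n) x]) := by
        rw [Ideal.ofList_append, ← hIfs, Ideal.map_sup]
        congr 1
        rw [Ideal.map_span, Set.image_singleton, Ideal.ofList_singleton]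
      rw [this]; exact h2.2

lemma hc_mul {n : ℕ} (p q : MvPolynomial (Fin n) ℂ) (e d : ℕ) (hq : q.IsHomogeneous e) :
    homogeneousComponent d (p * q) = if e ≤ d then homogeneousComponent (d - e) p * q else 0 := by
  letI := MvPolynomial.gradedAlgebra (σ := Fin n) (R := ℂ)
  have hd : ∀ (p : MvPolynomial (Fin n) ℂ) i, ((DirectSum.decompose (homogeneousSubmodule (Fin n) ℂ) p) i :
      MvPolynomial (Fin n) ℂ) = homogeneousComponent i p := fun p i => decomposition.decompose'_apply p i
  have := DirectSum.coe_decompose_mul_of_right_mem (homogeneousSubmodule (Fin n) ℂ) (a := p) d hq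
  rw [hd, hd] at this
  exact this

lemma hom_coeffs {n : ℕ} {ι : Type*} [Fintype ι] (g : ι → MvPolynomial (Fin n) ℂ) (m : ι → ℕ)
    (hg : ∀ i, (g i).IsHomogeneous (m i)) (p : MvPolynomial (Fin n) ℂ) (d : ℕ)
    (hpI : p ∈ Ideal.span (Set.range g)) :
    ∃ h : ι → MvPolynomial (Fin n) ℂ,
      (∀ i, h i = 0 ∨ ∃ e, e + m i = d ∧ (h i).IsHomogeneous e) ∧
      homogeneousComponent d p = ∑ i, h i * g i := by
  rw [Ideal.mem_span_range_iff_exists_fun] at hpI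
  obtain ⟨h, rfl⟩ := hpI
  refine ⟨fun i => if m i ≤ d then homogeneousComponent (d - m i) (h i) else 0, ?_, ?_⟩
  · intro i
    by_cases hi : m i ≤ d
    · right
      refine ⟨d - m i, by omega, ?_⟩
      simp only [hi, if_true]
      exact homogeneousComponent_isHomogeneous _ _
    · left; simp [hi]
  · rw [map_sum]
    refine Finset.sum_congr rfl fun i _ => ?_
    rw [hc_mul _ _ _ _ (hg i)]
    by_cases hi : m i ≤ d <;> simp [hi]

lemma hom_local {n : ℕ} {ι : Type*} [Fintype ι] (g : ι → MvPolynomial (Fin n) ℂ) (m : ι → ℕ)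
    (hg : ∀ i, (g i).IsHomogeneous (m i)) (p : MvPolynomial (Fin n) ℂ) (d : ℕ)
    (hp : p.IsHomogeneous d)
    (hpI : algebraMap _ (LO n) p ∈ (Ideal.span (Set.range g)).map (algebraMap _ (LO n))) :
    p ∈ Ideal.span (Set.range g) := by
  rw [IsLocalization.algebraMap_mem_map_algebraMap_iff (mO n).primeCompl] at hpI
  obtain ⟨s, hs, hsp⟩ := hpI
  obtain ⟨h, -, hh⟩ := hom_coeffs g m hg _ d hsp
  rw [hc_mul _ _ _ _ hp, if_pos le_rfl, Nat.sub_self, homogeneousComponent_zero] at hh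
  have hs0 : coeff 0 s ≠ 0 := by
    intro h0
    apply hs
    rw [SetLike.mem_coe, mem_vI, eval_zero, constantCoeff_eq]
    exact h0
  have : p = C (coeff 0 s)⁻¹ * ∑ i, h i * g i := by
    rw [← hh, ← mul_assoc, ← C_mul, inv_mul_cancel₀ hs0, C_1, one_mul]
  rw [this]
  exact Ideal.mul_mem_left _ _ (Ideal.sum_mem _ fun i _ =>
    Ideal.mul_mem_left _ _ (Ideal.subset_span ⟨i, rfl⟩))

end partE

section partF
open MvPolynomial

lemma hom_eval_zero {n d : ℕ} {p : MvPolynomial (Fin n) ℂ} (hp : p.IsHomogeneous d) (hd : d ≠ 0) :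
    eval 0 p = 0 := by
  rw [eval_zero, constantCoeff_eq]
  exact hp.coeff_eq_zero (by simpa using hd.symm)

lemma det_hom {n c : ℕ} (A : Matrix (Fin c) (Fin c) (MvPolynomial (Fin n) ℂ)) (D : Fin c → ℕ)
    (h : ∀ i j, (A i j).IsHomogeneous (D j)) : A.det.IsHomogeneous (∑ j, D j) := by
  rw [Matrix.det_apply]
  refine IsHomogeneous.sum _ _ _ fun σ _ => ?_
  have h1 : (∏ i, A (σ i) i).IsHomogeneous (∑ j, D j) :=
    IsHomogeneous.prod _ _ _ fun i _ => h _ _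
  rw [← mem_homogeneousSubmodule] at h1 ⊢
  rw [Units.smul_def]
  exact zsmul_mem h1 _

lemma minorJ_hom {n c : ℕ} (f : Fin c → MvPolynomial (Fin n) ℂ) (m : Fin c → ℕ)
    (hf : ∀ i, (f i).IsHomogeneous (m i)) (s : Fin c → Fin n) :
    (minorJ f s).IsHomogeneous (∑ j, (m j - 1)) :=
  det_hom _ _ fun _ j => (hf j).pderiv

lemma span_minor_hom {n c : ℕ} (f : Fin c → MvPolynomial (Fin n) ℂ) (m : Fin c → ℕ)
    (hf : ∀ i, (f i).IsHomogeneous (m i)) (x : MvPolynomial (Fin n) ℂ)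
    (hx : x ∈ Submodule.span ℂ (Set.range (minorJ f))) :
    x.IsHomogeneous (∑ j, (m j - 1)) := by
  rw [← mem_homogeneousSubmodule]
  refine (Submodule.span_le.2 ?_) hx
  rintro _ ⟨s, rfl⟩
  exact minorJ_hom f m hf s

lemma r_zero {n c : ℕ} (f : Fin c → MvPolynomial (Fin n) ℂ) (m : Fin c → ℕ)
    (hf : ∀ i, (f i).IsHomogeneous (m i)) (x : MvPolynomial (Fin n) ℂ)
    (hx : x ∈ Submodule.span ℂ (Set.range (minorJ f)))
    (hreg : ∀ z, algebraMap _ (LO n) x * z ∈ (Ideal.span (Set.range f)).map (algebraMap _ (LO n)) →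
        z ∈ (Ideal.span (Set.range f)).map (algebraMap _ (LO n)))
    (p : MvPolynomial (Fin n) ℂ) (d : ℕ) (hp : p.IsHomogeneous d)
    (hv : ∀ u, (∀ i, eval u (f i) = 0) → eval u p = 0) :
    p ∈ Ideal.span (Set.range f) := by
  have hrad : p ∈ (Ideal.span (Set.range f)).radical := by
    rw [← vanishingIdeal_zeroLocus_eq_radical (K := ℂ), mem_vanishingIdeal_iff]
    intro u hu
    rw [aeval_eq_eval]
    apply hv
    intro i
    have := hu (f i) (Ideal.subset_span ⟨i, rfl⟩)
    rwa [aeval_eq_eval] at this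
  let K : Ideal (MvPolynomial (Fin n) ℂ) := Submodule.comap
    (LinearMap.toSpanSingleton (MvPolynomial (Fin n) ℂ) _ p) (Ideal.span (Set.range f))
  have hK : ∀ a, a ∈ K ↔ a * p ∈ Ideal.span (Set.range f) := fun a => Iff.rfl
  have hxK : x ∈ K.radical := by
    have : Submodule.span ℂ (Set.range (minorJ f)) ≤ K.radical.restrictScalars ℂ := by
      rw [Submodule.span_le]
      rintro _ ⟨s, rfl⟩
      obtain ⟨M, hM⟩ := jac_pow_mem f s p hrad
      exact ⟨M, (hK _).2 hM⟩
    exact this hx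
  obtain ⟨M, hM⟩ := hxK
  rw [hK] at hM
  have key : ∀ M : ℕ, ∀ z, algebraMap _ (LO n) x ^ M * z ∈
      (Ideal.span (Set.range f)).map (algebraMap _ (LO n)) →
        z ∈ (Ideal.span (Set.range f)).map (algebraMap _ (LO n)) := by
    intro M
    induction M with
    | zero => intro z hz; simpa using hz
    | succ k ih =>
      intro z hz
      apply ih
      apply hreg
      rwa [← mul_assoc, ← pow_succ']
  apply hom_local f m hf p d hp
  apply key M
  rw [← map_pow, ← map_mul]
  exact Ideal.mem_map_of_mem _ hM

lemma cpoly {n c : ℕ} (f : Fin c → MvPolynomial (Fin n) ℂ) (m : Fin c → ℕ)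
    (hf : ∀ i, (f i).IsHomogeneous (m i)) (x : MvPolynomial (Fin n) ℂ)
    (hx : x ∈ Submodule.span ℂ (Set.range (minorJ f)))
    (φ : Fin n → MvPolynomial (Fin n) ℂ) (d : ℕ) (hφ : ∀ j, (φ j).IsHomogeneous d) :
    ∃ p : Fin c → MvPolynomial (Fin n) ℂ,
      (∀ i, (p i).IsHomogeneous (∑ j, Function.update (fun j => m j - 1) i d j)) ∧
      ∀ (u : Fin n → ℂ) (g : Fin c → ℂ),
        (∀ j, eval u (φ j) = ∑ i, g i * eval u (pderiv j (f i))) →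
        ∀ i, eval u (p i) = eval u x * g i := by
  rw [Submodule.mem_span_range_iff_exists_fun] at hx
  obtain ⟨a, rfl⟩ := hx
  refine ⟨fun i => ∑ s, a s • ((Matrix.of fun i j => pderiv (s i) (f j)).updateCol i
    (fun k => φ (s k))).det, ?_, ?_⟩
  · intro i
    rw [← mem_homogeneousSubmodule]
    refine Submodule.sum_mem _ fun s _ => Submodule.smul_mem _ _ ?_
    rw [mem_homogeneousSubmodule]
    refine det_hom _ _ fun k j => ?_
    by_cases hj : j = i
    · subst hj; simpa using hφ _
    · simpa [hj, Matrix.updateCol_ne] using (hf j).pderiv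
  · intro u g hg i
    simp only [smul_eq_C_mul, map_sum, map_mul, eval_C, Finset.sum_mul]
    refine Finset.sum_congr rfl fun s _ => ?_
    rw [mul_assoc]
    congr 1
    rw [eval_minorJ, RingHom.map_det]
    set A : Matrix (Fin c) (Fin c) ℂ := Matrix.of fun i j => eval u (pderiv (s i) (f j)) with hA
    have h1 : (eval u).mapMatrix ((Matrix.of fun i j => pderiv (s i) (f j)).updateCol i
        (fun k => φ (s k))) = A.updateCol i (A.mulVec g) := by
      ext k j
      by_cases hj : j = i
      · subst hj
        simp [hg, A, Matrix.mulVec, dotProduct, mul_comm]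
      · simp [hj, A, Matrix.updateCol_ne]
    rw [h1, ← Matrix.cramer_apply, Matrix.cramer_eq_adjugate_mulVec, Matrix.mulVec_mulVec,
      Matrix.adjugate_mul, Matrix.smul_mulVec, Matrix.one_mulVec]
    rfl

lemma conormal {n c : ℕ} (hc : 1 ≤ c) (hcn : c + 2 ≤ n) (f : Fin c → MvPolynomial (Fin n) ℂ)
    (m : Fin c → ℕ) (hf : ∀ i, (f i).IsHomogeneous (m i)) (hm : ∀ i, 2 ≤ m i)
    (hli : ∀ u : Fin n → ℂ, u ≠ 0 → (∀ i, eval u (f i) = 0) →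
      LinearIndependent ℂ (fun i : Fin c => fun j : Fin n => eval u (pderiv j (f i)))) :
    (∀ p d, p.IsHomogeneous d → (∀ u, (∀ i, eval u (f i) = 0) → eval u p = 0) →
      p ∈ Ideal.span (Set.range f)) ∧
    ∀ (φ : Fin n → MvPolynomial (Fin n) ℂ) (d : ℕ), (∀ j, (φ j).IsHomogeneous d) →
      (∀ u, u ≠ 0 → (∀ i, eval u (f i) = 0) → ∀ v : Fin n → ℂ,
        (∀ i, ∑ j, eval u (pderiv j (f i)) * v j = 0) → ∑ j, eval u (φ j) * v j = 0) →
      ∃ g : Fin c → MvPolynomial (Fin n) ℂ,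
        (∀ i, g i = 0 ∨ ∃ e, e + m i = d + 1 ∧ (g i).IsHomogeneous e) ∧
        ∀ u, (∀ i, eval u (f i) = 0) → ∀ j,
          eval u (φ j) = ∑ i, eval u (g i) * eval u (pderiv j (f i)) := by
  obtain ⟨x, hx, y, hy, hrx, hry⟩ := exists_xy hc hcn f
    (fun i => hom_eval_zero (hf i) (by have := hm i; omega))
    (fun i j => hom_eval_zero ((hf i).pderiv) (by have := hm i; omega)) hli
  have R0 := r_zero f m hf x hx hrx
  refine ⟨R0, ?_⟩
  intro φ d hφ hφv
  have hxh := span_minor_hom f m hf x hx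
  have hyh := span_minor_hom f m hf y hy
  have he : ∑ j, (m j - 1) ≠ 0 := by
    have : (m ⟨0, hc⟩ - 1) ≤ ∑ j, (m j - 1) :=
      Finset.single_le_sum (f := fun j => m j - 1) (fun _ _ => Nat.zero_le _) (Finset.mem_univ _)
    have := hm ⟨0, hc⟩
    omega
  have hx0 := hom_eval_zero hxh he
  have hy0 := hom_eval_zero hyh he
  obtain ⟨p, hp, hpv⟩ := cpoly f m hf x hx φ d hφ
  obtain ⟨q, hq, hqv⟩ := cpoly f m hf y hy φ d hφ
  have hE : ∀ i, ∑ j, Function.update (fun j => m j - 1) i d j + (m i - 1) =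
      ∑ j, (m j - 1) + d := by
    intro i
    rw [Finset.sum_update_of_mem (Finset.mem_univ i), ← Finset.add_sum_erase _ _ (Finset.mem_univ i),
      Finset.sdiff_singleton_eq_erase]
    omega
  -- pointwise coefficients
  have hpt : ∀ u, u ≠ 0 → (∀ i, eval u (f i) = 0) → ∃ g : Fin c → ℂ,
      ∀ j, eval u (φ j) = ∑ i, g i * eval u (pderiv j (f i)) := by
    intro u hu hfu
    let L : Fin c → ((Fin n → ℂ) →ₗ[ℂ] ℂ) := fun i =>
      ∑ j, (eval u (pderiv j (f i))) • LinearMap.proj j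
    let K : (Fin n → ℂ) →ₗ[ℂ] ℂ := ∑ j, (eval u (φ j)) • LinearMap.proj j
    have hL : ∀ i v, L i v = ∑ j, eval u (pderiv j (f i)) * v j := by
      intro i v; simp [L]
    have hK : ∀ v, K v = ∑ j, eval u (φ j) * v j := by
      intro v; simp [K]
    have := mem_span_of_iInf_ker_le_ker (L := L) (K := K) (by
      intro v hv
      simp only [Submodule.mem_iInf, LinearMap.mem_ker] at hv ⊢
      rw [hK]
      exact hφv u hu hfu v fun i => by rw [← hL]; exact hv i)
    rw [Submodule.mem_span_range_iff_exists_fun] at this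
    obtain ⟨g, hg⟩ := this
    refine ⟨g, fun j => ?_⟩
    have h1 := congrArg (fun T => T (Pi.single j 1)) hg
    simp only [hK, LinearMap.sum_apply, LinearMap.smul_apply, hL, smul_eq_mul] at h1
    simpa [Pi.single_apply] using h1.symm
  have hpq : ∀ i, y * p i ∈ Ideal.span (Set.range f) ⊔ Ideal.span {x} := by
    intro i
    have : y * p i - x * q i ∈ Ideal.span (Set.range f) := by
      refine R0 _ (∑ j, (m j - 1) + ∑ j, Function.update (fun j => m j - 1) i d j)
        ((hyh.mul (hp i)).sub (hxh.mul (hq i))) ?_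
      intro u hu
      by_cases hu0 : u = 0
      · subst hu0; rw [map_sub, map_mul, map_mul, hx0, hy0]; ring
      · obtain ⟨g, hg⟩ := hpt u hu0 hu
        rw [map_sub, map_mul, map_mul, hpv u g hg, hqv u g hg]; ring
    have h2 := Ideal.add_mem _ (Ideal.mem_sup_left (T := Ideal.span {x}) this)
      (Ideal.mem_sup_right (S := Ideal.span (Set.range f))
        (Ideal.mul_mem_right (q i) _ (Ideal.mem_span_singleton_self x)))
    simpa using h2
  let F : Option (Fin c) → MvPolynomial (Fin n) ℂ := fun o => o.elim x f
  let mF : Option (Fin c) → ℕ := fun o => o.elim (∑ j, (m j - 1)) m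
  have hF : ∀ o, (F o).IsHomogeneous (mF o) := by
    intro o; cases o
    · exact hxh
    · exact hf _
  have hFI : Ideal.span (Set.range f) ⊔ Ideal.span {x} = Ideal.span (Set.range F) := by
    rw [← Ideal.span_union]
    congr 1
    ext r
    simp [F, Option.exists, or_comm, eq_comm]
  have hcoef : ∀ i, ∃ h : MvPolynomial (Fin n) ℂ, (h = 0 ∨ ∃ e, e + m i = d + 1 ∧ h.IsHomogeneous e) ∧
      p i - h * x ∈ Ideal.span (Set.range f) := by
    intro i
    have h1 : p i ∈ Ideal.span (Set.range F) := by
      apply hom_local F mF hF _ _ (hp i)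
      rw [← hFI]
      apply hry
      rw [← map_mul]
      exact Ideal.mem_map_of_mem _ (hpq i)
    obtain ⟨h, hh, heq⟩ := hom_coeffs F mF hF (p i) _ h1
    rw [homogeneousComponent_of_mem (n := ∑ j, Function.update (fun j => m j - 1) i d j) (hp i), if_pos rfl, Fintype.sum_option] at heq
    refine ⟨h none, ?_, ?_⟩
    · rcases hh none with h0 | ⟨e, he, heh⟩
      · exact Or.inl h0
      · refine Or.inr ⟨e, ?_, heh⟩
        have h2 := hE i
        have h3 := hm i
        change e + ∑ j, (m j - 1) = _ at he
        omega
    · rw [heq]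
      change h none * x + ∑ i, h (some i) * f i - h none * x ∈ _
      rw [add_sub_cancel_left]
      exact Ideal.sum_mem _ fun k _ => Ideal.mul_mem_left _ _ (Ideal.subset_span ⟨k, rfl⟩)
  choose g hg hgI using hcoef
  have hIv : ∀ r ∈ Ideal.span (Set.range f), ∀ u, (∀ i, eval u (f i) = 0) → eval u r = 0 := by
    intro r hr u hu
    have : Ideal.span (Set.range f) ≤ RingHom.ker (eval u) := by
      rw [Ideal.span_le]
      rintro _ ⟨i, rfl⟩
      exact hu i
    exact this hr
  refine ⟨g, hg, ?_⟩
  intro u hu j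
  have hψh : (φ j - ∑ i, g i * pderiv j (f i)).IsHomogeneous d := by
    refine (hφ j).sub (IsHomogeneous.sum _ _ _ fun i _ => ?_)
    rcases hg i with h0 | ⟨e, he, heh⟩
    · rw [h0, zero_mul]; exact isHomogeneous_zero _ _ _
    · have := heh.mul ((hf i).pderiv (i := j))
      have h3 := hm i
      rwa [show e + (m i - 1) = d by omega] at this
  have hxψ : x * (φ j - ∑ i, g i * pderiv j (f i)) ∈ Ideal.span (Set.range f) := by
    refine R0 _ _ (hxh.mul hψh) ?_
    intro u hu
    by_cases hu0 : u = 0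
    · subst hu0; rw [map_mul, hx0, zero_mul]
    · obtain ⟨γ, hγ⟩ := hpt u hu0 hu
      rw [map_mul, map_sub, hγ, map_sum, mul_sub, Finset.mul_sum, Finset.mul_sum,
        ← Finset.sum_sub_distrib]
      refine Finset.sum_eq_zero fun i _ => ?_
      have h1 := hIv _ (hgI i) u hu
      rw [map_sub, map_mul, hpv u γ hγ] at h1
      rw [map_mul]
      linear_combination eval u (pderiv j (f i)) * h1
  have hψ : φ j - ∑ i, g i * pderiv j (f i) ∈ Ideal.span (Set.range f) := by
    apply hom_local f m hf _ _ hψh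
    apply hrx
    rw [← map_mul]
    exact Ideal.mem_map_of_mem _ hxψ
  have := hIv _ hψ u hu
  rw [map_sub, map_sum, sub_eq_zero] at this
  simpa using this

end partF

section partH
open MvPolynomial

lemma hom_zero_C {n : ℕ} {p : MvPolynomial (Fin n) ℂ} (hp : p.IsHomogeneous 0) :
    ∃ a, p = C a :=
  ⟨_, totalDegree_eq_zero_iff_eq_C.1 ((totalDegree_zero_iff_isHomogeneous _).2 hp)⟩

lemma hom_one_lin {n : ℕ} {p : MvPolynomial (Fin n) ℂ} (hp : p.IsHomogeneous 1) :
    ∃ L : (Fin n → ℂ) →ₗ[ℂ] ℂ, ∀ u, eval u p = L u := by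
  have h1 := hp.sum_X_mul_pderiv
  have h2 : ∀ j, ∃ a, pderiv j p = C a := fun j => hom_zero_C (hp.pderiv (i := j))
  choose a ha using h2
  refine ⟨∑ j, a j • LinearMap.proj j, fun u => ?_⟩
  rw [one_smul] at h1
  conv_lhs => rw [← h1]
  simp [ha, mul_comm]

lemma lin_zero {n : ℕ} (Z : Set (Fin n → ℂ)) (hZ : Submodule.span ℂ Z = ⊤)
    (L : (Fin n → ℂ) →ₗ[ℂ] ℂ) (h : ∀ u ∈ Z, u ≠ 0 → L u = 0) : L = 0 := by
  apply LinearMap.ext_on hZ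
  intro u hu
  by_cases h0 : u = 0
  · subst h0; simp
  · simpa using h u hu h0

lemma exists_ne_zero_mem {n : ℕ} (hn : 0 < n) (Z : Set (Fin n → ℂ))
    (hZ : Submodule.span ℂ Z = ⊤) : ∃ u ∈ Z, u ≠ 0 := by
  by_contra hcon
  push Not at hcon
  have h1 : Submodule.span ℂ Z = ⊥ := Submodule.span_eq_bot.2 hcon
  rw [hZ] at h1
  have : (Pi.single ⟨0, hn⟩ 1 : Fin n → ℂ) ∈ (⊤ : Submodule ℂ (Fin n → ℂ)) := trivial
  rw [h1, Submodule.mem_bot] at this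
  have := congrFun this ⟨0, hn⟩
  simp at this

lemma p_one {n e : ℕ} (hn : 0 < n) (he : e ≤ 1) (Z : Set (Fin n → ℂ))
    (hZ : Submodule.span ℂ Z = ⊤) (p : MvPolynomial (Fin n) ℂ) (hp : p.IsHomogeneous e)
    (h : ∀ u ∈ Z, u ≠ 0 → eval u p = 0) : p = 0 := by
  interval_cases e
  · obtain ⟨a, rfl⟩ := hom_zero_C hp
    obtain ⟨u, hu, hu0⟩ := exists_ne_zero_mem hn Z hZ
    have := h u hu hu0
    rw [eval_C] at this
    rw [this, C_0]
  · obtain ⟨L, hL⟩ := hom_one_lin hp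
    have := lin_zero Z hZ L (fun u hu h0 => by rw [← hL]; exact h u hu h0)
    apply MvPolynomial.funext
    intro u
    rw [hL, this]; simp

lemma wed {n c : ℕ} (hn : 0 < n) (f : Fin c → MvPolynomial (Fin n) ℂ)
    (m : Fin c → ℕ) (hf : ∀ i, (f i).IsHomogeneous (m i)) (hm : ∀ i, 2 ≤ m i)
    (hli : ∀ u : Fin n → ℂ, u ≠ 0 → (∀ i, eval u (f i) = 0) →
      LinearIndependent ℂ (fun i : Fin c => fun j : Fin n => eval u (pderiv j (f i))))
    (hspan : Submodule.span ℂ {u : Fin n → ℂ | ∀ i, eval u (f i) = 0} = ⊤)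
    (R0 : ∀ p d, p.IsHomogeneous d → (∀ u, (∀ i, eval u (f i) = 0) → eval u p = 0) →
      p ∈ Ideal.span (Set.range f))
    {ι : Type} [Fintype ι] (k : ι → Fin n) (hk : Function.Injective k)
    (Q : ι → MvPolynomial (Fin n) ℂ) (hQ : ∀ i, (Q i).IsHomogeneous 2)
    (hQv : ∀ i u, (∀ i, eval u (f i) = 0) → eval u (Q i) = 0)
    (hsum : ∑ i, X (k i) * Q i = 0) : ∀ i, Q i = 0 := by
  have h1 : ∀ i, ∃ a : Fin c → ℂ, Q i = ∑ j, C (a j) * f j := by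
    intro i
    obtain ⟨h, hh, heq⟩ := hom_coeffs f m hf (Q i) 2 (R0 _ _ (hQ i) (hQv i))
    rw [homogeneousComponent_of_mem (n := 2) (hQ i), if_pos rfl] at heq
    have : ∀ j, ∃ a, h j = C a := by
      intro j
      rcases hh j with h0 | ⟨e, he, heh⟩
      · exact ⟨0, by rw [h0, C_0]⟩
      · have := hm j
        obtain rfl : e = 0 := by omega
        exact hom_zero_C heh
    choose a ha using this
    exact ⟨a, by rw [heq]; simp only [ha]⟩
  choose a ha using h1
  let L : Fin c → ((Fin n → ℂ) →ₗ[ℂ] ℂ) := fun j => ∑ i, a i j • LinearMap.proj (k i)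
  have hL : ∀ j u, L j u = ∑ i, a i j * u (k i) := by intro j u; simp [L]
  have hL0 : ∀ j, L j = 0 := by
    intro j
    apply lin_zero _ hspan
    intro u hu hu0
    have hlin := Fintype.linearIndependent_iff.1 (hli u hu0 hu) (fun j => L j u) (by
      funext l
      have h2 := congrArg (fun p => eval u (pderiv l p)) hsum
      simp only [map_sum, map_zero, Derivation.leibniz, smul_eq_mul, map_add, map_mul, eval_X] at h2
      have h3 : ∀ i, eval u (Q i) = 0 := fun i => hQv i u hu
      simp only [h3, zero_mul, add_zero] at h2
      simp only [Finset.sum_apply, Pi.smul_apply, smul_eq_mul, Pi.zero_apply, hL]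
      rw [← h2]
      simp only [Finset.sum_mul]
      rw [Finset.sum_comm]
      refine Finset.sum_congr rfl fun i _ => ?_
      rw [ha i, map_sum, map_sum, Finset.mul_sum]
      refine Finset.sum_congr rfl fun j _ => ?_
      simp
      ring)
    exact hlin j
  intro i
  rw [ha i]
  refine Finset.sum_eq_zero fun j _ => ?_
  have h2 := hL j (Pi.single (k i) 1)
  rw [hL0 j] at h2
  have h3 : a i j = 0 := by
    classical
    simpa [Pi.single_apply, hk.eq_iff] using h2.symm
  rw [h3, C_0, zero_mul]

lemma lin_expand {n : ℕ} (L : (Fin n → ℂ) →ₗ[ℂ] ℂ) (u : Fin n → ℂ) :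
    L u = ∑ j, u j * L (Pi.single j 1) := by
  conv_lhs => rw [pi_eq_sum_univ' u, map_sum]
  refine Finset.sum_congr rfl fun j _ => ?_
  rw [map_smul, smul_eq_mul]

lemma radial {n : ℕ} (hn : 0 < n) (t : Fin n → ((Fin n → ℂ) →ₗ[ℂ] ℂ))
    (h : ∀ a b u, u a * t b u = u b * t a u) : ∃ l : ℂ, ∀ b u, t b u = l * u b := by
  have h1 : ∀ k b, k ≠ b → t b (Pi.single k 1) = 0 := by
    intro k b hkb
    have := h k b (Pi.single k 1)
    simpa [Pi.single_apply, hkb.symm] using this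
  have h2 : ∀ k b, t b (Pi.single b 1) = t k (Pi.single k 1) := by
    intro k b
    by_cases hkb : k = b
    · subst hkb; rfl
    have := h k b (Pi.single k 1 + Pi.single b 1)
    simp only [map_add, h1 k b hkb, h1 b k (Ne.symm hkb), Pi.add_apply, Pi.single_apply] at this
    simpa [hkb, Ne.symm hkb] using this
  refine ⟨t ⟨0, hn⟩ (Pi.single ⟨0, hn⟩ 1), fun b u => ?_⟩
  rw [lin_expand, Finset.sum_eq_single b]
  · rw [h2 ⟨0, hn⟩ b]; ring
  · intro j _ hj
    rw [h1 j b hj, mul_zero]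
  · simp

lemma koszul {n : ℕ} (hn : 2 < n) (G : Fin n → Fin n → ((Fin n → ℂ) →ₗ[ℂ] ℂ))
    (hanti : ∀ a b u, G a b u = - G b a u)
    (hcyc : ∀ a b d, a ≠ b → a ≠ d → b ≠ d → ∀ u,
      u d * G a b u + u a * G b d u + u b * G d a u = 0) :
    ∃ h : Fin n → ℂ, ∀ a b u, G a b u = u a * h b - u b * h a := by
  have h1 : ∀ a b k, a ≠ b → a ≠ k → b ≠ k → G a b (Pi.single k 1) = 0 := by
    intro a b k hab hak hbk
    have := hcyc a b k hab hak hbk (Pi.single k 1)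
    simpa [Pi.single_apply, hak, hbk] using this
  have h2 : ∀ a b d, a ≠ b → d ≠ b → G a b (Pi.single a 1) = G d b (Pi.single d 1) := by
    intro a b d hab hdb
    by_cases hae : a = d
    · subst hae; rfl
    have := hcyc a b d hab hae hdb.symm (Pi.single a 1 + Pi.single d 1)
    simp only [map_add, h1 a b d hab hae hdb.symm, h1 b d a hdb.symm hab.symm (Ne.symm hae),
      Pi.add_apply, Pi.single_apply] at this
    rw [hanti b d] at this
    simp [hae, Ne.symm hae, hab.symm, hdb.symm] at this
    linear_combination this
  have h3 : ∀ b : Fin n, ∃ a, a ≠ b := fun b =>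
    (Fin.exists_ne_and_ne_of_two_lt b b hn).imp fun _ h => h.1
  choose s hs using h3
  refine ⟨fun b => G (s b) b (Pi.single (s b) 1), fun a b u => ?_⟩
  by_cases hab : a = b
  · subst hab
    have := hanti a a u
    linear_combination (1/2 : ℂ) * this
  rw [lin_expand, Finset.sum_eq_add a b hab]
  · rw [h2 a b (s b) hab (hs b), hanti a b, h2 b a (s a) (Ne.symm hab) (hs a)]; ring
  · intro j _ hj
    rw [h1 a b j hab (Ne.symm hj.1) (Ne.symm hj.2), mul_zero]
  · simp
  · simp

end partH

section partJ
open MvPolynomial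

lemma inj_three {α : Type*} {a b c : α} (h1 : a ≠ b) (h2 : a ≠ c) (h3 : b ≠ c) :
    Function.Injective ![a, b, c] := by
  intro p q h
  fin_cases p <;> fin_cases q <;>
    first
    | rfl
    | exact (h1 h).elim
    | exact (h1 h.symm).elim
    | exact (h2 h).elim
    | exact (h2 h.symm).elim
    | exact (h3 h).elim
    | exact (h3 h.symm).elim

lemma inj_four {α : Type*} {a b c d : α} (h1 : a ≠ b) (h2 : a ≠ c) (h3 : a ≠ d) (h4 : b ≠ c)
    (h5 : b ≠ d) (h6 : c ≠ d) : Function.Injective ![a, b, c, d] := by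
  intro p q h
  fin_cases p <;> fin_cases q <;>
    first
    | rfl
    | exact (h1 h).elim
    | exact (h1 h.symm).elim
    | exact (h2 h).elim
    | exact (h2 h.symm).elim
    | exact (h3 h).elim
    | exact (h3 h.symm).elim
    | exact (h4 h).elim
    | exact (h4 h.symm).elim
    | exact (h5 h).elim
    | exact (h5 h.symm).elim
    | exact (h6 h).elim
    | exact (h6 h.symm).elim

lemma ker_zero {n c : ℕ} (hc : 1 ≤ c) (hcn : c + 2 ≤ n) (f : Fin c → MvPolynomial (Fin n) ℂ)
    (m : Fin c → ℕ) (hf : ∀ i, (f i).IsHomogeneous (m i)) (hm : ∀ i, 2 ≤ m i)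
    (hconic : ∀ i, m i = 2 → 3 < n)
    (hli : ∀ u : Fin n → ℂ, u ≠ 0 → (∀ i, eval u (f i) = 0) →
      LinearIndependent ℂ (fun i : Fin c => fun j : Fin n => eval u (pderiv j (f i))))
    (hspan : Submodule.span ℂ {u : Fin n → ℂ | ∀ i, eval u (f i) = 0} = ⊤)
    (σ : (Fin n → ℂ) →ₗ[ℂ] (Fin n → ℂ) →ₗ[ℂ] (Fin n → ℂ)) (halt : ∀ u v, σ u v = - σ v u)
    (hker : ∀ u, (∀ i, eval u (f i) = 0) → u ≠ 0 → ∀ v : Fin n → ℂ,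
      (∀ i, ∑ j, eval u (pderiv j (f i)) * v j = 0) → ∃ a : ℂ, σ u v = a • u) : σ = 0 := by
  have hn0 : 0 < n := by omega
  have hn2 : 2 < n := by omega
  obtain ⟨R0, CN⟩ := conormal hc hcn f m hf hm hli
  have W3 := fun k hk Q hQ hQv hs =>
    wed hn0 f m hf hm hli hspan R0 (ι := Fin 3) k hk Q hQ hQv hs
  have W4 := fun k hk Q hQ hQv hs =>
    wed hn0 f m hf hm hli hspan R0 (ι := Fin 4) k hk Q hQ hQv hs
  let S : Fin n → Fin n → MvPolynomial (Fin n) ℂ := fun j b =>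
    ∑ k, C (σ (Pi.single k 1) (Pi.single j 1) b) * X k
  have hSh : ∀ j b, (S j b).IsHomogeneous 1 := by
    intro j b
    refine IsHomogeneous.sum _ _ _ fun k _ => ?_
    simpa using (isHomogeneous_C (Fin n) _).mul (isHomogeneous_X ℂ k)
  have hS : ∀ j b u, eval u (S j b) = σ u (Pi.single j 1) b := by
    intro j b u
    have := lin_expand ((LinearMap.proj b).comp (σ.flip (Pi.single j 1))) u
    simp only [LinearMap.comp_apply, LinearMap.flip_apply, LinearMap.proj_apply] at this
    rw [this]
    simp [S, mul_comm]
  have hσ : ∀ u v b, σ u v b = ∑ j, eval u (S j b) * v j := by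
    intro u v b
    have := lin_expand ((LinearMap.proj b).comp (σ u)) v
    simp only [LinearMap.comp_apply, LinearMap.proj_apply] at this
    rw [this]
    simp [hS, mul_comm]
  have hg1 : ∀ a b, ∃ g : Fin c → MvPolynomial (Fin n) ℂ,
        (∀ i, (g i).IsHomogeneous (3 - m i) ∧ (3 < m i → g i = 0)) ∧
        ∀ u, (∀ i, eval u (f i) = 0) → ∀ j,
          eval u (X a * S j b - X b * S j a) =
            ∑ i, eval u (g i) * eval u (pderiv j (f i)) := by
    intro a b
    obtain ⟨g, hg, hgv⟩ := CN (fun j => X a * S j b - X b * S j a) 2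
      (fun j => ((isHomogeneous_X ℂ a).mul (hSh j b)).sub ((isHomogeneous_X ℂ b).mul (hSh j a)))
      (by
        intro u hu0 hu v hv
        obtain ⟨r, hr⟩ := hker u hu hu0 v hv
        have hb := hσ u v b
        have ha := hσ u v a
        rw [hr] at ha hb
        simp only [Pi.smul_apply, smul_eq_mul] at ha hb
        simp only [map_sub, map_mul, eval_X, sub_mul, Finset.sum_sub_distrib, mul_assoc]
        rw [← Finset.mul_sum, ← Finset.mul_sum, ← ha, ← hb]
        ring)
    refine ⟨g, fun i => ?_, hgv⟩
    rcases hg i with h0 | ⟨e, he, heh⟩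
    · rw [h0]; exact ⟨isHomogeneous_zero _ _ _, fun _ => rfl⟩
    · obtain rfl : e = 3 - m i := by omega
      exact ⟨heh, fun h => by omega⟩
  choose g hg hgv using hg1
  have hanti : ∀ a b i, g a b i + g b a i = 0 := by
    intro a b i
    refine p_one hn0 (e := 3 - m i) (by have := hm i; omega) _ hspan _
      ((hg a b i).1.add (hg b a i).1) ?_
    intro u hu hu0
    have hlin := Fintype.linearIndependent_iff.1 (hli u hu0 hu)
      (fun i => eval u (g a b i + g b a i)) (by
      funext j
      have h1 := hgv a b u hu j
      have h2 := hgv b a u hu j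
      simp only [map_sub, map_mul, eval_X] at h1 h2
      simp only [Finset.sum_apply, Pi.smul_apply, smul_eq_mul, Pi.zero_apply, map_add, add_mul,
        Finset.sum_add_distrib]
      rw [← h1, ← h2]; ring)
    exact hlin i
  have hcycv : ∀ a b d i u, (∀ i, eval u (f i) = 0) → u ≠ 0 →
      eval u (X d * g a b i + X a * g b d i + X b * g d a i) = 0 := by
    intro a b d i u hu hu0
    have hlin := Fintype.linearIndependent_iff.1 (hli u hu0 hu)
      (fun i => eval u (X d * g a b i + X a * g b d i + X b * g d a i)) (by
      funext j
      have h1 := hgv a b u hu j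
      have h2 := hgv b d u hu j
      have h3 := hgv d a u hu j
      simp only [map_sub, map_mul, eval_X] at h1 h2 h3
      simp only [Finset.sum_apply, Pi.smul_apply, smul_eq_mul, Pi.zero_apply, map_add, map_mul,
        eval_X, add_mul, Finset.sum_add_distrib, mul_assoc]
      rw [← Finset.mul_sum, ← Finset.mul_sum, ← Finset.mul_sum, ← h1, ← h2, ← h3]; ring)
    exact hlin i
  have hcych : ∀ a b d i, (X d * g a b i + X a * g b d i + X b * g d a i).IsHomogeneous
      (1 + (3 - m i)) := by
    intro a b d i
    exact (((isHomogeneous_X ℂ d).mul (hg a b i).1).add ((isHomogeneous_X ℂ a).mul (hg b d i).1)).add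
      ((isHomogeneous_X ℂ b).mul (hg d a i).1)
  -- coefficients
  have hh : ∀ i, ∃ h : Fin n → ℂ, (m i ≠ 2 → h = 0) ∧
      ∀ a b u, eval u (g a b i) = u a * h b - u b * h a := by
    intro i
    by_cases h2 : m i = 2
    · have hn3 := hconic i h2
      have hG : ∀ a b, ∃ L : (Fin n → ℂ) →ₗ[ℂ] ℂ, ∀ u, eval u (g a b i) = L u := by
        intro a b
        apply hom_one_lin
        have := (hg a b i).1
        rwa [h2] at this
      choose G hG using hG
      obtain ⟨h, hh⟩ := koszul hn2 G (by
        intro a b u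
        have := congrArg (eval u) (hanti a b i)
        rw [map_add, hG, hG, map_zero] at this
        linear_combination this) (by
        intro a b d hab had hbd u
        obtain ⟨e, he⟩ : ∃ e, e ∉ ({a, b, d} : Finset (Fin n)) := by
          by_contra hcon
          push Not at hcon
          have h1 : (Finset.univ : Finset (Fin n)).card ≤ ({a, b, d} : Finset (Fin n)).card :=
            Finset.card_le_card fun x _ => hcon x
          have h2 := Finset.card_le_three (a := a) (b := b) (c := d)
          simp at h1
          omega
        simp only [Finset.mem_insert, Finset.mem_singleton, not_or] at he
        obtain ⟨hea, heb, hed⟩ := he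
        have hQh : ∀ a b d, (X d * g a b i + X a * g b d i + X b * g d a i).IsHomogeneous 2 := by
          intro a b d
          have := hcych a b d i
          rwa [h2] at this
        have hQv : ∀ a b d u, (∀ i, eval u (f i) = 0) →
            eval u (X d * g a b i + X a * g b d i + X b * g d a i) = 0 := by
          intro a b d u hu
          by_cases hu0 : u = 0
          · subst hu0; exact hom_eval_zero (hQh a b d) (by norm_num)
          · exact hcycv a b d i u hu hu0
        have key := W4 ![e, d, a, b] (inj_four hed hea heb had.symm hbd.symm hab)
          ![X d * g a b i + X a * g b d i + X b * g d a i,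
            -(X e * g a b i + X a * g b e i + X b * g e a i),
            -(X e * g b d i + X b * g d e i + X d * g e b i),
            X e * g a d i + X a * g d e i + X d * g e a i]
          (by
            intro p
            fin_cases p
            · exact hQh a b d
            · exact (hQh a b e).neg
            · exact (hQh b d e).neg
            · exact hQh a d e)
          (by
            intro p u hu
            fin_cases p
            · exact hQv a b d u hu
            · change eval u (-_) = 0
              rw [map_neg, hQv a b e u hu, neg_zero]
            · change eval u (-_) = 0
              rw [map_neg, hQv b d e u hu, neg_zero]
            · exact hQv a d e u hu)
          (by
            rw [Fin.sum_univ_four]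
            change X e * (X d * g a b i + X a * g b d i + X b * g d a i) +
              X d * -(X e * g a b i + X a * g b e i + X b * g e a i) +
              X a * -(X e * g b d i + X b * g d e i + X d * g e b i) +
              X b * (X e * g a d i + X a * g d e i + X d * g e a i) = 0
            linear_combination X e * X b * hanti d a i - X d * X a * hanti b e i) 0
        have key2 := congrArg (eval u) key
        change eval u (X d * g a b i + X a * g b d i + X b * g d a i) = _ at key2
        simpa [hG] using key2)
      exact ⟨h, fun h => absurd h2 h, fun a b u => by rw [hG, hh]⟩
    · refine ⟨0, fun _ => rfl, fun a b u => ?_⟩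
      have h3 : g a b i = 0 := by
        by_cases h4 : 3 < m i
        · exact (hg a b i).2 h4
        have h3 : m i = 3 := by have := hm i; omega
        by_cases hab : a = b
        · subst hab
          have := hanti a a i
          rw [← two_mul] at this
          simpa using this
        obtain ⟨d, hda, hdb⟩ := Fin.exists_ne_and_ne_of_two_lt a b hn2
        have h5 := p_one hn0 (e := 1) le_rfl _ hspan _ (by
          have := hcych a b d i
          rwa [h3] at this) (fun u hu hu0 => hcycv a b d i u hu hu0)
        have h6 := (hg a b i).1
        rw [h3] at h6
        obtain ⟨r, hr⟩ := hom_zero_C h6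
        have h7 := congrArg (eval (Pi.single d 1)) h5
        rw [hr]
        simp [hr, hda.symm, hdb.symm] at h7
        rw [h7, C_0]
      rw [h3]; simp
  choose h hh0 hh using hh
  let t : Fin n → Fin n → MvPolynomial (Fin n) ℂ := fun j b =>
    S j b - ∑ i, C (h i b) * pderiv j (f i)
  have hth : ∀ j b, (t j b).IsHomogeneous 1 := by
    intro j b
    refine (hSh j b).sub (IsHomogeneous.sum _ _ _ fun i _ => ?_)
    by_cases h2 : m i = 2
    · have := (isHomogeneous_C (Fin n) (h i b)).mul ((hf i).pderiv (i := j))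
      rwa [h2] at this
    · rw [hh0 i h2]
      simp only [Pi.zero_apply, C_0, zero_mul]
      exact isHomogeneous_zero _ _ _
  have hTh : ∀ j a b, (X a * t j b - X b * t j a).IsHomogeneous 2 := fun j a b =>
    ((isHomogeneous_X ℂ a).mul (hth j b)).sub ((isHomogeneous_X ℂ b).mul (hth j a))
  have hTv : ∀ j a b u, (∀ i, eval u (f i) = 0) → eval u (X a * t j b - X b * t j a) = 0 := by
    intro j a b u hu
    have h1 := hgv a b u hu j
    simp only [hh, sub_mul, Finset.sum_sub_distrib, mul_assoc, map_sub, map_mul, eval_X] at h1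
    simp only [t, map_sub, map_mul, map_sum, eval_X, eval_C]
    rw [← Finset.mul_sum, ← Finset.mul_sum] at h1
    linear_combination h1
  have hT : ∀ j a b, X a * t j b - X b * t j a = 0 := by
    intro j a b
    by_cases hab : a = b
    · subst hab; ring
    obtain ⟨d, hda, hdb⟩ := Fin.exists_ne_and_ne_of_two_lt a b hn2
    exact W3 ![d, a, b] (inj_three hda hdb hab)
      ![X a * t j b - X b * t j a, X b * t j d - X d * t j b, X d * t j a - X a * t j d]
      (by
        intro p
        fin_cases p
        · exact hTh j a b
        · exact hTh j b d
        · exact hTh j d a)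
      (by
        intro p u hu
        fin_cases p
        · exact hTv j a b u hu
        · exact hTv j b d u hu
        · exact hTv j d a u hu)
      (by
        rw [Fin.sum_univ_three]
        change X d * (X a * t j b - X b * t j a) + X a * (X b * t j d - X d * t j b) +
          X b * (X d * t j a - X a * t j d) = 0
        ring) 0
  have hlam : ∀ j, ∃ l : ℂ, ∀ b u, eval u (t j b) = l * u b := by
    intro j
    have h1 : ∀ b, ∃ L : (Fin n → ℂ) →ₗ[ℂ] ℂ, ∀ u, eval u (t j b) = L u :=
      fun b => hom_one_lin (hth j b)
    choose L hL using h1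
    obtain ⟨l, hl⟩ := radial hn0 L (by
      intro a b u
      have := congrArg (eval u) (hT j a b)
      simp only [map_sub, map_mul, eval_X, hL, map_zero] at this
      linear_combination this)
    exact ⟨l, fun b u => by rw [hL, hl]⟩
  choose l hl using hlam
  have hfin : ∀ u v b, σ u v b = ∑ i, h i b * ∑ j, eval u (pderiv j (f i)) * v j +
      (∑ j, l j * v j) * u b := by
    intro u v b
    rw [hσ]
    simp only [Finset.mul_sum]
    rw [Finset.sum_comm, Finset.sum_mul, ← Finset.sum_add_distrib]
    refine Finset.sum_congr rfl fun j _ => ?_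
    have := hl j b u
    simp only [t, map_sub, map_mul, map_sum, eval_C] at this
    rw [sub_eq_iff_eq_add] at this
    rw [this, add_mul, Finset.sum_mul, add_comm]
    congr 1
    · exact Finset.sum_congr rfl fun i _ => by ring
    · ring
  have hss : ∀ u, σ u u = 0 := by
    intro u
    have := halt u u
    funext b
    have := congrFun this b
    simp only [Pi.neg_apply] at this
    simp only [Pi.zero_apply]
    linear_combination (1/2 : ℂ) * this
  have heul : ∀ i u, ∑ j, eval u (pderiv j (f i)) * u j = m i * eval u (f i) := by
    intro i u
    have := congrArg (eval u) (hf i).sum_X_mul_pderiv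
    simpa [mul_comm] using this
  have hdiag : ∀ u b, 0 = ∑ i, h i b * (m i * eval u (f i)) + (∑ j, l j * u j) * u b := by
    intro u b
    have := hfin u u b
    rw [hss] at this
    simpa only [heul, Pi.zero_apply] using this
  let Λ : (Fin n → ℂ) →ₗ[ℂ] ℂ := ∑ j, l j • LinearMap.proj j
  have hΛ : ∀ u, Λ u = ∑ j, l j * u j := by intro u; simp [Λ]
  have hΛ0 : Λ = 0 := by
    apply lin_zero _ hspan
    intro u hu hu0
    by_contra hcon
    apply hu0
    funext b
    have h1 := hdiag u b
    have hu' : ∀ i, eval u (f i) = 0 := hu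
    simp only [hu', mul_zero, Finset.sum_const_zero, zero_add, ← hΛ] at h1
    simpa [hcon] using h1.symm
  have hpol : ∀ b, ∑ i, C (h i b * m i) * f i = 0 := by
    intro b
    apply MvPolynomial.funext
    intro u
    have h1 := hdiag u b
    rw [← hΛ, hΛ0, LinearMap.zero_apply, zero_mul, add_zero] at h1
    rw [map_sum, map_zero, h1]
    exact Finset.sum_congr rfl fun i _ => by rw [map_mul, eval_C]; ring
  obtain ⟨w, hw, hw0⟩ := exists_ne_zero_mem hn0 _ hspan
  have hh00 : ∀ i b, h i b = 0 := by
    intro i b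
    have hlin := Fintype.linearIndependent_iff.1 (hli w hw0 hw) (fun i => h i b * m i) (by
      funext j
      have := congrArg (fun p => eval w (pderiv j p)) (hpol b)
      simp only [map_sum, map_zero, Derivation.leibniz, smul_eq_mul, map_add, map_mul, pderiv_C,
        eval_C, mul_zero, add_zero] at this
      simpa using this) i
    have h2 : (m i : ℂ) ≠ 0 := by
      have := hm i
      exact_mod_cast (by omega : m i ≠ 0)
    simpa [h2] using hlin
  apply LinearMap.ext
  intro u
  apply LinearMap.ext
  intro v
  funext b
  rw [hfin, ← hΛ, hΛ0]
  simp [hh00]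

end partJ

section partJJ

lemma dim_arg {E : Type} [AddCommGroup E] [Module ℂ E] (P : Submodule ℂ E) {H : Type}
    [AddCommGroup H] [Module ℂ H] [FiniteDimensional ℂ H] {r : ℕ} (hr : Module.finrank ℂ H = r)
    (ζ : P →ₗ[ℂ] H) (hζ : ∀ s, ζ s = 0 → s.1 = 0) {D : Type} [AddCommGroup D] [Module ℂ D]
    (hD : Module.finrank ℂ D = r) (B : D →ₗ[ℂ] E) (hB : Function.Injective B)
    (hle : LinearMap.range B ≤ P) : ∀ s ∈ P, ∃ d, B d = s := by
  have hinj : Function.Injective ζ := by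
    rw [injective_iff_map_eq_zero]
    intro s hs
    exact Subtype.ext (hζ s hs)
  have hfd : FiniteDimensional ℂ P := FiniteDimensional.of_injective ζ hinj
  have heq : LinearMap.range B = P := by
    apply Submodule.eq_of_le_of_finrank_le hle
    rw [LinearMap.finrank_range_of_inj hB, hD, ← hr]
    exact LinearMap.finrank_le_finrank_of_injective hinj
  intro s hs
  rw [← heq] at hs
  exact hs

end partJJ


open MvPolynomial

/-- Let `Z ⊂ ℙV` (`V = ℂ^{N+1}`) be a positive-dimensional nonsingular
nondegenerate complete intersection of positive codimension which is not a plane conic,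
such that `dim H⁰(Z, T_Z ⊗ Ω_Z ⊗ O_Z(1)) = dim V`.  Then `Ξ_Z = Ξ_V`: every alternating
bilinear `σ : Λ²V → V` with `σ(u,v) ∈ T_u(Ẑ)` for all `u ∈ Ẑ` and `v ∈ T_u(Ẑ)` satisfies
`σ(u,v) ∈ ℂu + ℂv` for all `u, v ∈ V`.

Formalization: `Z` is cut out by homogeneous `f_i` of degree `m_i`, with affine cone
`Ẑ = Zhat`, affine tangent spaces `Tang u`, smooth punctured cone and spanning cone
(nondegeneracy).  The space `H⁰(Z, T_Z ⊗ Ω_Z ⊗ O_Z(1))` is the finite-dimensional space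
`H0` (of dimension `dim V = N+1` by hypothesis), and `ζ : Ξ_Z → H⁰(Z, T_Z⊗Ω_Z⊗O(1))` is
the canonical evaluation map `ζ(σ)_α(u ⊗ [v]) = [σ(u,v)]`, characterized here by its
kernel condition: `ζ(σ) = 0` iff `σ(u,v) ∈ ℂu` for all `u ∈ Ẑ∖0`, `v ∈ T_u(Ẑ)`. -/
theorem stmt19 (N c : ℕ) (hc : 1 ≤ c) (hdim : c < N)
    (f : Fin c → MvPolynomial (Fin (N + 1)) ℂ)
    (m : Fin c → ℕ) (hf : ∀ i, (f i).IsHomogeneous (m i))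
    (hnotconic : ¬(N = 2 ∧ c = 1 ∧ ∀ i, m i = 2))  -- `Z` is not a plane conic
    (Zhat : Set (Fin (N + 1) → ℂ)) (hZ : Zhat = {u | ∀ i, eval u (f i) = 0})
    (Tang : (Fin (N + 1) → ℂ) → Set (Fin (N + 1) → ℂ))
    (hTang : ∀ u, Tang u = {v | ∀ i, ∑ j, eval u (pderiv j (f i)) * v j = 0})
    (hsmooth : ∀ u ∈ Zhat, u ≠ 0 →
      LinearIndependent ℂ (fun i : Fin c => fun j : Fin (N + 1) => eval u (pderiv j (f i))))
    (hnondeg : Submodule.span ℂ Zhat = ⊤)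
    -- `Ξ_Z ⊂ Hom(Λ²V, V)`:
    (ΞZ : Submodule ℂ ((Fin (N + 1) → ℂ) →ₗ[ℂ] (Fin (N + 1) → ℂ) →ₗ[ℂ] (Fin (N + 1) → ℂ)))
    (hΞZ : ∀ σ, σ ∈ ΞZ ↔ ((∀ u v, σ u v = - σ v u) ∧
      ∀ u ∈ Zhat, u ≠ 0 → ∀ v ∈ Tang u, σ u v ∈ Tang u))
    -- the space `H⁰(Z, T_Z ⊗ Ω_Z ⊗ O_Z(1))`, of dimension `dim V`:
    (H0 : Type) [AddCommGroup H0] [Module ℂ H0] [FiniteDimensional ℂ H0]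
    (hH0dim : Module.finrank ℂ H0 = N + 1)
    -- the canonical map `ζ : Ξ_Z → H⁰(Z, T_Z ⊗ Ω_Z ⊗ O_Z(1))`, whose kernel is `Ξ'_Z`:
    (ζ : ΞZ →ₗ[ℂ] H0)
    (hζ : ∀ σ : ΞZ, ζ σ = 0 ↔
      ∀ u ∈ Zhat, u ≠ 0 → ∀ v ∈ Tang u, ∃ a : ℂ, (σ : ((Fin (N + 1) → ℂ) →ₗ[ℂ] (Fin (N + 1) → ℂ) →ₗ[ℂ] (Fin (N + 1) → ℂ))) u v = a • u) :
    ∀ σ ∈ ΞZ, ∀ u v : Fin (N + 1) → ℂ,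
      σ u v ∈ Submodule.span ℂ ({u, v} : Set (Fin (N + 1) → ℂ)) := by
  have hZm : ∀ u, u ∈ Zhat ↔ ∀ i, eval u (f i) = 0 := fun u => by rw [hZ]; rfl
  have hTm : ∀ u v, v ∈ Tang u ↔ ∀ i, ∑ j, eval u (pderiv j (f i)) * v j = 0 :=
    fun u v => by rw [hTang]; rfl
  have hli : ∀ u : Fin (N + 1) → ℂ, u ≠ 0 → (∀ i, eval u (f i) = 0) →
      LinearIndependent ℂ (fun i : Fin c => fun j : Fin (N + 1) => eval u (pderiv j (f i))) :=
    fun u hu0 hu => hsmooth u ((hZm u).2 hu) hu0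
  have hspan : Submodule.span ℂ {u : Fin (N + 1) → ℂ | ∀ i, eval u (f i) = 0} = ⊤ := by
    rw [← hZ]; exact hnondeg
  obtain ⟨w, hw, hw0⟩ := exists_ne_zero_mem (Nat.succ_pos N) _ hspan
  have hm : ∀ i, 2 ≤ m i := by
    intro i
    by_contra hcon
    have hz : f i = 0 := by
      by_cases h0 : m i = 0
      · have h1 := hf i
        rw [h0] at h1
        obtain ⟨a, ha⟩ := hom_zero_C h1
        have := hw i
        rw [ha, eval_C] at this
        rw [ha, this, C_0]
      · have h1 : m i = 1 := by omega
        have h2 := hf i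
        rw [h1] at h2
        exact p_one (Nat.succ_pos N) le_rfl _ hspan _ h2 (fun u hu _ => hu i)
    apply (hli w hw0 hw).ne_zero i
    funext j
    simp [hz]
  have hconic : ∀ i, m i = 2 → 3 < N + 1 := by
    intro i hi
    by_contra hcon
    have hN : N = 2 := by omega
    have hc1 : c = 1 := by omega
    apply hnotconic
    refine ⟨hN, hc1, fun k => ?_⟩
    subst hc1
    rw [Subsingleton.elim k i, hi]
  have hζinj : ∀ σ, ζ σ = 0 → σ.1 = 0 := by
    intro σ hσ
    rw [hζ] at hσ
    refine ker_zero hc (by omega) f m hf hm hconic hli hspan σ.1 ((hΞZ σ.1).1 σ.2).1 ?_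
    intro u hu hu0 v hv
    exact hσ u ((hZm u).2 hu) hu0 v ((hTm u v).2 hv)
  let B : ((Fin (N + 1) → ℂ) →ₗ[ℂ] ℂ) →ₗ[ℂ]
      ((Fin (N + 1) → ℂ) →ₗ[ℂ] (Fin (N + 1) → ℂ) →ₗ[ℂ] (Fin (N + 1) → ℂ)) :=
    { toFun := fun L => LinearMap.mk₂ ℂ (fun u v => L u • v - L v • u)
        (by intro a b v; simp only [map_add, add_smul, smul_add]; abel)
        (by intro r a v; simp only [map_smul, smul_eq_mul, mul_smul, smul_sub]
            rw [smul_comm r (L v) a])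
        (by intro a b v; simp only [map_add, add_smul, smul_add]; abel)
        (by intro r a v; simp only [map_smul, smul_eq_mul, mul_smul, smul_sub]
            rw [smul_comm r (L a) v])
      map_add' := by
        intro L M
        apply LinearMap.ext; intro u; apply LinearMap.ext; intro v
        simp only [LinearMap.mk₂_apply, LinearMap.add_apply, add_smul]
        abel
      map_smul' := by
        intro r L
        apply LinearMap.ext; intro u; apply LinearMap.ext; intro v
        simp only [LinearMap.mk₂_apply, LinearMap.smul_apply, smul_eq_mul, mul_smul, smul_sub,
          RingHom.id_apply] }
  have hB : ∀ L u v, B L u v = L u • v - L v • u := fun L u v => rfl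
  have hBinj : Function.Injective B := by
    rw [injective_iff_map_eq_zero]
    intro L hL
    have hN : 2 < N + 1 := by omega
    apply LinearMap.pi_ext'
    intro a
    apply LinearMap.ext_ring
    obtain ⟨d, hd, -⟩ := Fin.exists_ne_and_ne_of_two_lt a a hN
    have h1 := hB L (Pi.single a 1) (Pi.single d 1)
    rw [hL] at h1
    have h2 := congrFun h1 d
    simpa [hd, hd.symm] using h2.symm
  have hrange : LinearMap.range B ≤ ΞZ := by
    rintro _ ⟨L, rfl⟩
    rw [hΞZ]
    refine ⟨fun u v => by rw [hB, hB]; abel, ?_⟩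
    intro u hu hu0 v hv
    rw [hTm] at hv ⊢
    intro i
    have heul : ∑ j, eval u (pderiv j (f i)) * u j = 0 := by
      have := congrArg (eval u) (hf i).sum_X_mul_pderiv
      rw [map_nsmul, (hZm u).1 hu i] at this
      simpa [mul_comm] using this
    have h1 : ∀ j, eval u (pderiv j (f i)) * (B L u v) j =
        L u * (eval u (pderiv j (f i)) * v j) - L v * (eval u (pderiv j (f i)) * u j) := by
      intro j
      rw [hB]
      simp only [Pi.sub_apply, Pi.smul_apply, smul_eq_mul]
      ring
    rw [Finset.sum_congr rfl fun j _ => h1 j, Finset.sum_sub_distrib, ← Finset.mul_sum,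
      ← Finset.mul_sum, hv i, heul]
    ring
  intro σ hσ u v
  obtain ⟨L, rfl⟩ := dim_arg ΞZ hH0dim ζ hζinj (D := (Fin (N + 1) → ℂ) →ₗ[ℂ] ℂ)
    (by rw [Module.finrank_linearMap]; simp) B hBinj hrange σ hσ
  rw [hB]
  exact Submodule.sub_mem _ (Submodule.smul_mem _ _ (Submodule.subset_span (by simp)))
    (Submodule.smul_mem _ _ (Submodule.subset_span (by simp)))
end
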